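/- arXiv:1208.3213 — 2 statements merged into one kernel-verified Lean document; each statement's English description precedes it below -/
import Mathlib

section
/- Suppose there exists a weakly pathwise optimal admissible strategy u*. Then every mean-optimal strategy ũ is also weakly pathwise optimal. -/
open MeasureTheory Filter Set
open scoped ENNReal Topology symmDiff

noncomputable section

namespace ErgodicDecisions

variable {Ω U : Type*}

/-- The `ℤ`-indexed iterates of an invertible transformation `T` with inverse `S`:
`iter T S n = Tⁿ` for `n ≥ 0` and `iter T S (-n) = Sⁿ`. -/
def iter (T S : Ω → Ω) : ℤ → Ω → Ω
  | Int.ofNat n => T^[n]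
  | Int.negSucc n => S^[n + 1]

variable {m0 : MeasurableSpace Ω} [mU : MeasurableSpace U]

/-- The observation σ-field `𝒴_{m,n} = ⋁_{k=m}^{n} T^{-k} 𝒴`. -/
def obsField (T S : Ω → Ω) (Y : MeasurableSpace Ω) (m n : ℤ) : MeasurableSpace Ω :=
  ⨆ k ∈ Set.Icc m n, MeasurableSpace.comap (iter T S k) Y

/-- The observation σ-field `𝒴_{-∞,n} = ⋁_{k ≤ n} T^{-k} 𝒴`. -/
def obsFieldLE (T S : Ω → Ω) (Y : MeasurableSpace Ω) (n : ℤ) : MeasurableSpace Ω :=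
  ⨆ k ∈ Set.Iic n, MeasurableSpace.comap (iter T S k) Y

/-- `𝕌_{m,n}`: the set of `𝒴_{m,n}`-measurable decision maps `Ω → U`. -/
def Umn (T S : Ω → Ω) (Y : MeasurableSpace Ω) (m n : ℤ) : Set (Ω → U) :=
  {v | Measurable[obsField T S Y m n] v}

/-- `𝕌_n = ⋃_{m ≤ n} 𝕌_{m,n}`. -/
def Un (T S : Ω → Ω) (Y : MeasurableSpace Ω) (n : ℤ) : Set (Ω → U) :=
  ⋃ m ∈ Set.Iic n, Umn T S Y m n

/-- The loss at time `n` of the decision map `v`: `ℓ_n(v)(ω) = ℓ(v(ω), Tⁿω)`. -/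
def lossAt (T S : Ω → Ω) (ℓ : U → Ω → ℝ) (n : ℤ) (v : Ω → U) (ω : Ω) : ℝ :=
  ℓ (v ω) (iter T S n ω)

/-- An admissible strategy: `u_k` is `𝒴_{0,k}`-measurable for every `k ≥ 1`. -/
def Admissible (T S : Ω → Ω) (Y : MeasurableSpace Ω) (u : ℕ → Ω → U) : Prop :=
  ∀ k : ℕ, 1 ≤ k → u k ∈ Umn T S Y 0 (k : ℤ)

/-- The time-average loss `L_T(u) = T⁻¹ ∑_{k=1}^T ℓ_k(u_k)`. -/
def avgLoss (T S : Ω → Ω) (ℓ : U → Ω → ℝ) (u : ℕ → Ω → U) (n : ℕ) (ω : Ω) : ℝ :=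
  (n : ℝ)⁻¹ * ∑ k ∈ Finset.Icc 1 n, lossAt T S ℓ (k : ℤ) (u k) ω

/-- `g` is an essential infimum (an a.e.-greatest lower bound among random variables)
of the family `(f i)_{i ∈ S₀}` under `P`. -/
def IsEssInfFam {ι : Type*} (P : Measure Ω) (S₀ : Set ι) (f : ι → Ω → ℝ) (g : Ω → ℝ) : Prop :=
  Measurable[m0] g ∧ (∀ i ∈ S₀, ∀ᵐ ω ∂P, g ω ≤ f i ω) ∧
    ∀ h : Ω → ℝ, Measurable[m0] h → (∀ i ∈ S₀, ∀ᵐ ω ∂P, h ω ≤ f i ω) → ∀ᵐ ω ∂P, h ω ≤ g ω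

/-- `g` is an essential supremum (an a.e.-least upper bound among random variables)
of the family `(f i)_{i ∈ S₀}` under `P`. -/
def IsEssSupFam {ι : Type*} (P : Measure Ω) (S₀ : Set ι) (f : ι → Ω → ℝ) (g : Ω → ℝ) : Prop :=
  Measurable[m0] g ∧ (∀ i ∈ S₀, ∀ᵐ ω ∂P, f i ω ≤ g ω) ∧
    ∀ h : Ω → ℝ, Measurable[m0] h → (∀ i ∈ S₀, ∀ᵐ ω ∂P, f i ω ≤ h ω) → ∀ᵐ ω ∂P, g ω ≤ h ω

/-- A mean-optimal strategy in the sense of Lemma 2.5 of the paper: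
`E[ℓ_k(ũ_k)|𝒴_{0,k}] ≤ ess inf_{u ∈ 𝕌_{0,k}} E[ℓ_k(u)|𝒴_{0,k}] + 1/k` a.s. for all `k ≥ 1`. -/
def MeanOptimalStrategy (P : Measure Ω) (T S : Ω → Ω) (Y : MeasurableSpace Ω)
    (ℓ : U → Ω → ℝ) (ut : ℕ → Ω → U) : Prop :=
  Admissible T S Y ut ∧
    ∀ k : ℕ, 1 ≤ k → ∃ g : Ω → ℝ,
      IsEssInfFam P (Umn T S Y 0 (k : ℤ))
        (fun v => P[lossAt T S ℓ (k : ℤ) v | obsField T S Y 0 (k : ℤ)]) g ∧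
      ∀ᵐ ω ∂P, (P[lossAt T S ℓ (k : ℤ) (ut k) | obsField T S Y 0 (k : ℤ)]) ω ≤ g ω + (k : ℝ)⁻¹

/-- Pathwise optimality (Definition 2.2). -/
def PathwiseOptimal (P : Measure Ω) (T S : Ω → Ω) (Y : MeasurableSpace Ω)
    (ℓ : U → Ω → ℝ) (us : ℕ → Ω → U) : Prop :=
  Admissible T S Y us ∧
    ∀ u : ℕ → Ω → U, Admissible T S Y u →
      ∀ᵐ ω ∂P,
        0 ≤ Filter.liminf (fun n : ℕ => avgLoss T S ℓ u n ω - avgLoss T S ℓ us n ω) atTop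

/-- Weak pathwise optimality (Definition 2.3). -/
def WeaklyPathwiseOptimal (P : Measure Ω) (T S : Ω → Ω) (Y : MeasurableSpace Ω)
    (ℓ : U → Ω → ℝ) (us : ℕ → Ω → U) : Prop :=
  Admissible T S Y us ∧
    ∀ u : ℕ → Ω → U, Admissible T S Y u → ∀ ε : ℝ, 0 < ε →
      Tendsto (fun n : ℕ => P {ω | -ε ≤ avgLoss T S ℓ u n ω - avgLoss T S ℓ us n ω})
        atTop (𝓝 1)

/-- Mean optimality (Definition 2.4). -/
def MeanOptimal (P : Measure Ω) (T S : Ω → Ω) (Y : MeasurableSpace Ω)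
    (ℓ : U → Ω → ℝ) (us : ℕ → Ω → U) : Prop :=
  Admissible T S Y us ∧
    ∀ u : ℕ → Ω → U, Admissible T S Y u →
      0 ≤ Filter.liminf
        (fun n : ℕ => (∫ ω, avgLoss T S ℓ u n ω ∂P) - ∫ ω, avgLoss T S ℓ us n ω ∂P) atTop

/-- Two σ-fields on `Ω` agree modulo `P`-null sets. -/
def EqModP (P : Measure Ω) (m₁ m₂ : MeasurableSpace Ω) : Prop :=
  (∀ A : Set Ω, MeasurableSet[m₁] A → ∃ B : Set Ω, MeasurableSet[m₂] B ∧ P (A ∆ B) = 0) ∧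
    ∀ A : Set Ω, MeasurableSet[m₂] A → ∃ B : Set Ω, MeasurableSet[m₁] B ∧ P (A ∆ B) = 0

/-- Conditional K-automorphism relative to `Z` (Definition 1.4); `S` is the inverse of `T`,
so that `T^{-k}𝒳 = comap T^k 𝒳` and `T^{k}𝒳 = comap S^k 𝒳`. -/
def CondK (P : Measure Ω) (T S : Ω → Ω) (Z : MeasurableSpace Ω) : Prop :=
  ∃ X : MeasurableSpace Ω, X ≤ m0 ∧
    X ≤ MeasurableSpace.comap T X ∧
    EqModP P (⨆ k : ℕ, MeasurableSpace.comap (T^[k + 1]) X) m0 ∧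
    EqModP P (⨅ k : ℕ, Z ⊔ MeasurableSpace.comap (S^[k + 1]) X) Z

/-- Conditional weak mixing relative to `Z` (Definition 1.3); `S` is the inverse of `T`,
so that `T^k B = (S^[k])⁻¹ B`. -/
def CondWeakMixing (P : Measure Ω) (S : Ω → Ω) (Z : MeasurableSpace Ω) : Prop :=
  ∀ A B : Set Ω, MeasurableSet[m0] A → MeasurableSet[m0] B →
    Tendsto
      (fun n : ℕ => ∫ ω,
        (n : ℝ)⁻¹ * ∑ k ∈ Finset.Icc 1 n,
          |(P[(A ∩ S^[k] ⁻¹' B).indicator (fun _ => (1 : ℝ)) | Z]) ω -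
            (P[A.indicator (fun _ => (1 : ℝ)) | Z]) ω *
              (P[(S^[k] ⁻¹' B).indicator (fun _ => (1 : ℝ)) | Z]) ω| ∂P)
      atTop (𝓝 0)

/-- The tail σ-field `⋂_{k≥1} (𝒴_{-∞,0} ∨ T^k 𝒳)`. -/
def tailField (T S : Ω → Ω) (Y X : MeasurableSpace Ω) : MeasurableSpace Ω :=
  ⨅ k : ℕ, obsFieldLE T S Y 0 ⊔ MeasurableSpace.comap (S^[k + 1]) X

/-- The truncated loss `ℓ_0(v)·1_{Λ ≤ M}`. -/
def truncLoss (ℓ : U → Ω → ℝ) (Λ : Ω → ℝ) (M : ℝ) (v : Ω → U) (ω : Ω) : ℝ :=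
  if Λ ω ≤ M then ℓ (v ω) ω else 0

/-- `ℓ̄_0^M(v) = ℓ_0(v)·1_{Λ≤M} − E[ℓ_0(v)·1_{Λ≤M} | 𝒴_{-∞,0}]`. -/
def barLoss (P : Measure Ω) (T S : Ω → Ω) (Y : MeasurableSpace Ω)
    (ℓ : U → Ω → ℝ) (Λ : Ω → ℝ) (M : ℝ) (v : Ω → U) (ω : Ω) : ℝ :=
  truncLoss ℓ Λ M v ω - (P[truncLoss ℓ Λ M v | obsFieldLE T S Y 0]) ω

/-- The uniform conditional mixing assumption of Theorem 2.12:
`lim_{M→∞} limsup_{T→∞} E[(1/T)∑_{k=1}^T ess sup_{u,u'∈𝕌₀}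
|E[(ℓ̄₀^M(u)∘T^{-k})·ℓ̄₀^M(u')|𝒴_{-∞,0}]|] = 0`. -/
def UniformCondMixing (P : Measure Ω) (T S : Ω → Ω) (Y : MeasurableSpace Ω)
    (ℓ : U → Ω → ℝ) (Λ : Ω → ℝ) : Prop :=
  ∃ G : ℝ → ℕ → Ω → ℝ,
    (∀ (M : ℝ) (k : ℕ),
      IsEssSupFam P ((Un T S Y 0) ×ˢ (Un T S Y 0))
        (fun p ω =>
          |(P[(fun ω' => barLoss P T S Y ℓ Λ M p.1 (S^[k] ω') *
                barLoss P T S Y ℓ Λ M p.2 ω') | obsFieldLE T S Y 0]) ω|)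
        (G M k)) ∧
    Tendsto
      (fun M : ℝ =>
        Filter.limsup
          (fun n : ℕ => ∫ ω, (n : ℝ)⁻¹ * ∑ k ∈ Finset.Icc 1 n, G M k ω ∂P) atTop)
      atTop (𝓝 0)

/-- Equimeasurability of the loss (Definition 3.1): for every `ε > 0` there is a set of
probability at least `1-ε` on which the family `{ℓ(u,·) : u ∈ U}` is totally bounded
in `L^∞(P)`. -/
def Equimeasurable (P : Measure Ω) (ℓ : U → Ω → ℝ) : Prop :=
  ∀ ε : ℝ, 0 < ε → ∃ Ωε : Set Ω, MeasurableSet[m0] Ωε ∧ 1 - ENNReal.ofReal ε ≤ P Ωε ∧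
    ∀ δ : ℝ, 0 < δ → ∃ 𝒩 : Finset (Ω → ℝ), ∀ u : U, ∃ f ∈ 𝒩,
      eLpNorm (fun ω => Ωε.indicator (ℓ u) ω - f ω) ⊤ P ≤ ENNReal.ofReal δ


lemma iter_mp {m : MeasurableSpace Ω} (P : Measure Ω) (T S : Ω → Ω) (hT : MeasurePreserving T P P)
    (k : ℕ) : MeasurePreserving (iter T S (k : ℤ)) P P := by
  have : iter T S (k : ℤ) = T^[k] := rfl
  rw [this]
  exact hT.iterate k

lemma obsField_le {m : MeasurableSpace Ω} (T S : Ω → Ω)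
    (hT : Measurable[m, m] T) (Y : MeasurableSpace Ω) (hY : Y ≤ m) (n : ℤ) :
    obsField T S Y 0 n ≤ m := by
  refine iSup₂_le fun k hk => ?_
  obtain ⟨j, rfl⟩ := Int.eq_ofNat_of_zero_le hk.1
  have : Measurable[m, m] (iter T S (j : ℤ)) := @Measurable.iterate Ω m T hT j
  exact (MeasurableSpace.comap_mono hY).trans this.comap_le

lemma cesaro_inv : Tendsto (fun n : ℕ => (n : ℝ)⁻¹ * ∑ k ∈ Finset.Icc 1 n, (k : ℝ)⁻¹)
    atTop (𝓝 0) := by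
  have h := (tendsto_one_div_add_atTop_nhds_zero_nat (𝕜 := ℝ)).cesaro
  refine h.congr fun n => ?_
  congr 1
  rw [← Finset.Ico_add_one_right_eq_Icc, Finset.sum_Ico_eq_sum_range]
  refine Finset.sum_congr (by simp) fun k _ => ?_
  push_cast
  rw [one_div, add_comm]

lemma tail_tendsto [MeasurableSpace Ω] (P : Measure Ω) (Λ : Ω → ℝ) (hΛ : Integrable Λ P) :
    Tendsto (fun M : ℕ => ∫ ω, max (Λ ω - M) 0 ∂P) atTop (𝓝 0) := by
  have h : Tendsto (fun M : ℕ => ∫ ω, max (Λ ω - M) 0 ∂P) atTop (𝓝 (∫ _ω : Ω, (0:ℝ) ∂P)) := by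
    refine tendsto_integral_of_dominated_convergence (fun ω => |Λ ω|) ?_ hΛ.abs ?_ ?_
    · intro n
      exact ((hΛ.aestronglyMeasurable.sub aestronglyMeasurable_const).sup
        aestronglyMeasurable_const)
    · intro n
      refine Eventually.of_forall fun ω => ?_
      have hn : (0:ℝ) ≤ n := Nat.cast_nonneg n
      rw [Real.norm_eq_abs, abs_of_nonneg (le_max_right _ _)]
      exact max_le ((sub_le_self _ hn).trans (le_abs_self _)) (abs_nonneg _)
    · refine Eventually.of_forall fun ω => ?_
      refine tendsto_const_nhds.congr' ?_
      obtain ⟨N, hN⟩ := exists_nat_ge (Λ ω)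
      filter_upwards [eventually_ge_atTop N] with n hn
      have : (N:ℝ) ≤ n := by exact_mod_cast hn
      rw [max_eq_right]
      linarith
  simpa using h

lemma tendsto_one_iff [MeasurableSpace Ω] (P : Measure Ω) [IsProbabilityMeasure P]
    (A : ℕ → Set Ω) (hA : ∀ n, MeasurableSet (A n)) :
    Tendsto (fun n => P (A n)) atTop (𝓝 1) ↔
      Tendsto (fun n => P.real (A n)ᶜ) atTop (𝓝 0) := by
  have h1 : Tendsto (fun n => P (A n)) atTop (𝓝 1) ↔
      Tendsto (fun n => P.real (A n)) atTop (𝓝 1) := by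
    have := ENNReal.tendsto_toReal_iff (fi := atTop) (f := fun n => P (A n)) (fun n => measure_ne_top P (A n))
      ENNReal.one_ne_top
    rw [ENNReal.toReal_one] at this
    exact this.symm
  rw [h1]
  have h2 : ∀ n, P.real (A n)ᶜ = 1 - P.real (A n) := fun n => probReal_compl_eq_one_sub (hA n)
  simp_rw [h2]
  constructor
  · intro h
    simpa using h.const_sub 1
  · intro h
    simpa using h.const_sub 1

lemma meas_loss {Ω U : Type*} {_ : MeasurableSpace Ω} [MeasurableSpace U] (P : Measure Ω)
    (T S : Ω → Ω) (hTm : MeasurePreserving T P P)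
    (ℓ : U → Ω → ℝ) (hℓ : Measurable fun p : U × Ω => ℓ p.1 p.2) (k : ℕ) (v : Ω → U)
    (h1 : Measurable v) : Measurable (lossAt T S ℓ (k : ℤ) v) :=
  hℓ.comp (h1.prodMk (iter_mp P T S hTm k).measurable)

lemma core {Ω U : Type*} {_ : MeasurableSpace Ω}
    (P : Measure Ω) [IsProbabilityMeasure P]
    (T S : Ω → Ω) (hTm : MeasurePreserving T P P)
    (ℓ : U → Ω → ℝ)
    (Λ : Ω → ℝ) (hΛ : Integrable Λ P) (hdom : ∀ u ω, |ℓ u ω| ≤ Λ ω)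
    (Adm : (ℕ → Ω → U) → Prop)
    (hlm : ∀ u : ℕ → Ω → U, Adm u → ∀ k : ℕ, 1 ≤ k →
      Measurable (lossAt T S ℓ (k : ℤ) (u k)))
    (us ut : ℕ → Ω → U) (hus : Adm us) (hadm : Adm ut)
    (hopt : ∀ u : ℕ → Ω → U, Adm u → ∀ ε : ℝ, 0 < ε →
      Tendsto (fun n : ℕ => P {ω | -ε ≤ avgLoss T S ℓ u n ω - avgLoss T S ℓ us n ω})
        atTop (𝓝 1))
    (hm : ∀ k : ℕ, 1 ≤ k → ∫ ω, lossAt T S ℓ (k : ℤ) (ut k) ω ∂P ≤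
      ∫ ω, lossAt T S ℓ (k : ℤ) (us k) ω ∂P + (k : ℝ)⁻¹) :
    ∀ u : ℕ → Ω → U, Adm u → ∀ ε : ℝ, 0 < ε →
      Tendsto (fun n : ℕ => P {ω | -ε ≤ avgLoss T S ℓ u n ω - avgLoss T S ℓ ut n ω})
        atTop (𝓝 1) := by
  have hli : ∀ u : ℕ → Ω → U, Adm u → ∀ k : ℕ, 1 ≤ k →
      Integrable (lossAt T S ℓ (k : ℤ) (u k)) P := by
    intro u hu k hk
    refine Integrable.mono' ((iter_mp P T S hTm k).integrable_comp_of_integrable hΛ)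
      (hlm u hu k hk).aestronglyMeasurable (Eventually.of_forall fun ω => hdom _ _)
  have ham : ∀ u : ℕ → Ω → U, Adm u → ∀ n, Measurable (avgLoss T S ℓ u n) := by
    intro u hu n
    refine Measurable.const_mul (Finset.measurable_fun_sum _ fun k hk => ?_) _
    exact hlm u hu k (Finset.mem_Icc.1 hk).1
  have hai : ∀ u : ℕ → Ω → U, Adm u → ∀ n, Integrable (avgLoss T S ℓ u n) P := by
    intro u hu n
    refine Integrable.const_mul (integrable_finsetSum _ fun k hk => ?_) _
    exact hli u hu k (Finset.mem_Icc.1 hk).1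
  have hae : ∀ u : ℕ → Ω → U, Adm u → ∀ n, ∫ ω, avgLoss T S ℓ u n ω ∂P =
      (n : ℝ)⁻¹ * ∑ k ∈ Finset.Icc 1 n, ∫ ω, lossAt T S ℓ (k : ℤ) (u k) ω ∂P := by
    intro u hu n
    unfold avgLoss
    rw [integral_const_mul, integral_finsetSum]
    intro k hk
    exact hli u hu k (Finset.mem_Icc.1 hk).1
  have hmD : ∀ n : ℕ, ∫ ω, (avgLoss T S ℓ ut n ω - avgLoss T S ℓ us n ω) ∂P ≤
      (n : ℝ)⁻¹ * ∑ k ∈ Finset.Icc 1 n, (k : ℝ)⁻¹ := by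
    intro n
    rw [integral_sub (hai ut hadm n) (hai us hus n), hae ut hadm, hae us hus, ← mul_sub,
      ← Finset.sum_sub_distrib]
    refine mul_le_mul_of_nonneg_left (Finset.sum_le_sum fun k hk => ?_) (by positivity)
    have := hm k (Finset.mem_Icc.1 hk).1
    linarith
  -- key inequality
  have hkey : ∀ ε : ℝ, 0 < ε → ∀ δ : ℝ, 0 < δ → ∀ M n : ℕ, 1 ≤ n →
      ε * P.real {ω | -ε ≤ avgLoss T S ℓ us n ω - avgLoss T S ℓ ut n ω}ᶜ ≤
        (n : ℝ)⁻¹ * ∑ k ∈ Finset.Icc 1 n, (k : ℝ)⁻¹ + δ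
        + 2 * M * P.real {ω | -δ ≤ avgLoss T S ℓ ut n ω - avgLoss T S ℓ us n ω}ᶜ
        + 2 * ∫ ω, max (Λ ω - M) 0 ∂P := by
    intro ε hε δ hδ M n hn
    have hn0 : (0:ℝ) < n := by exact_mod_cast hn
    set C := {ω | -ε ≤ avgLoss T S ℓ us n ω - avgLoss T S ℓ ut n ω}ᶜ with hC
    set B := {ω | -δ ≤ avgLoss T S ℓ ut n ω - avgLoss T S ℓ us n ω}ᶜ with hB
    have hCm : MeasurableSet C :=
      (measurableSet_le measurable_const ((ham us hus n).sub (ham ut hadm n))).compl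
    have hBm : MeasurableSet B :=
      (measurableSet_le measurable_const ((ham ut hadm n).sub (ham us hus n))).compl
    let R : Ω → ℝ := fun ω => max (Λ ω - M) 0
    have hR : Integrable R P := (hΛ.sub (integrable_const _)).sup (integrable_const _)
    have hRk : ∀ k : ℕ, Integrable (fun ω => R (iter T S (k:ℤ) ω)) P := fun k =>
      (iter_mp P T S hTm k).integrable_comp_of_integrable hR
    have hRe : ∀ k : ℕ, ∫ ω, R (iter T S (k:ℤ) ω) ∂P = ∫ ω, R ω ∂P := by
      intro k
      have hk := iter_mp P T S hTm k
      have := integral_map (μ := P) hk.measurable.aemeasurable (f := R)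
        (by rw [hk.map_eq]; exact hR.aestronglyMeasurable)
      rw [hk.map_eq] at this
      exact this.symm
    let A : Ω → ℝ := fun ω => (n:ℝ)⁻¹ * ∑ k ∈ Finset.Icc 1 n, R (iter T S (k:ℤ) ω)
    have hAi : Integrable A P := (integrable_finsetSum _ fun k _ => hRk k).const_mul _
    have hAe : ∫ ω, A ω ∂P = ∫ ω, R ω ∂P := by
      simp only [A]
      rw [integral_const_mul, integral_finsetSum _ fun k _ => hRk k]
      simp only [hRe, Finset.sum_const, Nat.card_Icc, nsmul_eq_mul, Nat.add_sub_cancel]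
      field_simp
    have hbd : ∀ (u : ℕ → Ω → U) ω, |avgLoss T S ℓ u n ω| ≤ M + A ω := by
      intro u ω
      unfold avgLoss
      rw [abs_mul, abs_of_nonneg (by positivity : (0:ℝ) ≤ (n:ℝ)⁻¹)]
      have h1 : |∑ k ∈ Finset.Icc 1 n, lossAt T S ℓ (k : ℤ) (u k) ω| ≤
          ∑ k ∈ Finset.Icc 1 n, ((M:ℝ) + R (iter T S (k:ℤ) ω)) := by
        refine (Finset.abs_sum_le_sum_abs _ _).trans (Finset.sum_le_sum fun k _ => ?_)
        have h2 := hdom (u k ω) (iter T S (k:ℤ) ω)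
        have h3 : Λ (iter T S (k:ℤ) ω) - M ≤ R (iter T S (k:ℤ) ω) := le_max_left _ _
        unfold lossAt
        linarith
      refine (mul_le_mul_of_nonneg_left h1 (by positivity)).trans_eq ?_
      simp only [A, Finset.sum_add_distrib, Finset.sum_const, Nat.card_Icc, nsmul_eq_mul,
        Nat.add_sub_cancel]
      field_simp
    have hA0 : ∀ ω, 0 ≤ A ω := fun ω =>
      mul_nonneg (by positivity) (Finset.sum_nonneg fun k _ => le_max_right _ _)
    have hpt : ∀ ω, C.indicator (fun _ => ε) ω ≤
        (avgLoss T S ℓ ut n ω - avgLoss T S ℓ us n ω) + δ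
          + B.indicator (fun _ => 2 * (M:ℝ)) ω + 2 * A ω := by
      intro ω
      have b1 := abs_le.1 (hbd ut ω)
      have b2 := abs_le.1 (hbd us ω)
      have hA := hA0 ω
      have hM0 : (0:ℝ) ≤ M := Nat.cast_nonneg M
      by_cases hc : ω ∈ C <;> by_cases hb : ω ∈ B <;>
        simp only [hc, hb, indicator_of_mem, indicator_of_notMem, not_false_eq_true] <;>
        simp only [hC, hB, mem_compl_iff, mem_ofPred_eq, not_le, not_lt] at hc hb <;> linarith
    have hDi : Integrable (fun ω => avgLoss T S ℓ ut n ω - avgLoss T S ℓ us n ω) P :=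
      (hai ut hadm n).sub (hai us hus n)
    have hBi : Integrable (B.indicator (fun _ => 2 * (M:ℝ))) P :=
      (integrable_const _).indicator hBm
    have hCi : Integrable (C.indicator (fun _ => ε)) P := (integrable_const _).indicator hCm
    have hDd : Integrable (fun ω => (avgLoss T S ℓ ut n ω - avgLoss T S ℓ us n ω) + δ) P :=
      hDi.add (integrable_const _)
    have hDB : Integrable (fun ω => (avgLoss T S ℓ ut n ω - avgLoss T S ℓ us n ω) + δ
          + B.indicator (fun _ => 2 * (M:ℝ)) ω) P := hDd.add hBi
    have hint := integral_mono hCi (hDB.add (hAi.const_mul 2)) hpt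
    simp only [Pi.add_apply] at hint
    rw [integral_add hDB (hAi.const_mul 2), integral_add hDd hBi,
      integral_add hDi (integrable_const _), integral_const_mul, hAe,
      integral_indicator_const _ hCm, integral_indicator_const _ hBm, integral_const] at hint
    simp only [smul_eq_mul, probReal_univ, one_mul] at hint
    have := hmD n
    change _ ≤ _ + 2 * ∫ ω, R ω ∂P
    linarith
  have hlim : ∀ ε : ℝ, 0 < ε → Tendsto (fun n : ℕ =>
      P.real {ω | -ε ≤ avgLoss T S ℓ us n ω - avgLoss T S ℓ ut n ω}ᶜ) atTop (𝓝 0) := by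
    intro ε hε
    rw [Metric.tendsto_atTop']
    intro η hη
    have hεη : 0 < ε * η := mul_pos hε hη
    obtain ⟨M, hM⟩ := ((tail_tendsto P Λ hΛ).eventually_lt_const
      (show (0:ℝ) < ε * η / 8 by positivity)).exists
    have hB := (tendsto_one_iff P _ fun n => measurableSet_le measurable_const
      ((ham ut hadm n).sub (ham us hus n))).1 (hopt ut hadm (ε * η / 4) (by positivity))
    have hB' := (hB.const_mul (2 * (M:ℝ)))
    rw [mul_zero] at hB'
    have hev := (hB'.eventually_lt_const (show (0:ℝ) < ε * η / 4 by positivity)).and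
      ((cesaro_inv.eventually_lt_const (show (0:ℝ) < ε * η / 4 by positivity)).and
        (eventually_ge_atTop 1))
    obtain ⟨N, hN⟩ := eventually_atTop.1 hev
    refine ⟨N, fun n hn => ?_⟩
    obtain ⟨h1, h2, h3⟩ := hN n hn.le
    have h4 := hkey ε hε (ε * η / 4) (by positivity) M n h3
    rw [Real.dist_eq, sub_zero, abs_of_nonneg measureReal_nonneg]
    refine lt_of_mul_lt_mul_left ?_ hε.le
    simp only [Pi.sub_apply] at h1
    linarith
  intro u hu ε hε
  refine (tendsto_one_iff P _ fun n => measurableSet_le measurable_const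
      ((ham u hu n).sub (ham ut hadm n))).2 ?_
  have hu1 := (tendsto_one_iff P _ fun n => measurableSet_le measurable_const
      ((ham u hu n).sub (ham us hus n))).1 (hopt u hu (ε / 2) (by positivity))
  have hu2 := hu1.add (hlim (ε / 2) (by positivity))
  rw [add_zero] at hu2
  refine squeeze_zero (fun n => measureReal_nonneg) (fun n => ?_) hu2
  refine (measureReal_mono ?_).trans (measureReal_union_le _ _)
  intro ω hω
  simp only [mem_union, mem_compl_iff, mem_ofPred_eq, not_le, Pi.sub_apply] at hω ⊢
  by_contra! h
  linarith [h.1, h.2]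

/-- Lemma 2.10: if some weakly pathwise optimal strategy exists, then every
mean-optimal strategy is also weakly pathwise optimal. -/
theorem statement5
    {Ω U : Type*} [m0 : MeasurableSpace Ω] [MeasurableSpace U]
    (P : Measure Ω) [IsProbabilityMeasure P]
    (T S : Ω → Ω) (hT : Ergodic T P) (hS : MeasurePreserving S P P)
    (hST : Function.LeftInverse S T) (hTS : Function.RightInverse S T)
    (ℓ : U → Ω → ℝ) (hℓ : Measurable fun p : U × Ω => ℓ p.1 p.2)
    (Λ : Ω → ℝ) (hΛ : Integrable Λ P) (hdom : ∀ u ω, |ℓ u ω| ≤ Λ ω)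
    (Y : MeasurableSpace Ω) (hY : Y ≤ m0)
    (hex : ∃ us : ℕ → Ω → U, WeaklyPathwiseOptimal P T S Y ℓ us)
    (ut : ℕ → Ω → U) (hut : MeanOptimalStrategy P T S Y ℓ ut) :
    WeaklyPathwiseOptimal P T S Y ℓ ut := by
  obtain ⟨us, hus, hopt⟩ := hex
  obtain ⟨hadm, hmean⟩ := hut
  have hTm := hT.toMeasurePreserving
  have hobs : ∀ n : ℤ, obsField T S Y 0 n ≤ m0 := obsField_le T S
    (@MeasurePreserving.measurable Ω Ω m0 m0 _ _ _ hTm) Y hY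
  have hlm : ∀ u : ℕ → Ω → U, Admissible T S Y u → ∀ k : ℕ, 1 ≤ k →
      Measurable[m0] (lossAt T S ℓ (k : ℤ) (u k)) := by
    intro u hu k hk
    have h1 : Measurable[m0] (u k) :=
      (show Measurable[obsField T S Y 0 k] (u k) from hu k hk).mono (hobs k) le_rfl
    exact meas_loss P T S hTm ℓ hℓ k (u k) h1
  -- mean comparison
  have hm : ∀ k : ℕ, 1 ≤ k → ∫ ω, lossAt T S ℓ (k : ℤ) (ut k) ω ∂P ≤
      ∫ ω, lossAt T S ℓ (k : ℤ) (us k) ω ∂P + (k : ℝ)⁻¹ := by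
    intro k hk
    obtain ⟨g, ⟨-, hg, -⟩, hgt⟩ := hmean k hk
    have hgs := hg (us k) (hus k hk)
    rw [← integral_condExp (hobs k) (f := lossAt T S ℓ (k : ℤ) (ut k)),
      ← integral_condExp (hobs k) (f := lossAt T S ℓ (k : ℤ) (us k))]
    have h3 : ∫ ω, ((P[lossAt T S ℓ (k : ℤ) (us k) | obsField T S Y 0 (k : ℤ)]) ω + (k:ℝ)⁻¹) ∂P =
      ∫ ω, (P[lossAt T S ℓ (k : ℤ) (us k) | obsField T S Y 0 (k : ℤ)]) ω ∂P + (k:ℝ)⁻¹ := by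
      rw [integral_add integrable_condExp (integrable_const _)]
      simp
    rw [← h3]
    refine integral_mono_ae integrable_condExp (integrable_condExp.add (integrable_const _)) ?_
    filter_upwards [hgs, hgt] with ω h1 h2
    linarith
  exact ⟨hadm, core P T S hTm ℓ Λ hΛ hdom (Admissible T S Y) hlm us ut hus hadm hopt hm⟩

end ErgodicDecisions
end
end

section
/- Let (Ω, ℬ, P) be a standard probability space, T an invertible measure-preserving ergodic transformation, and suppose the observation σ-field 𝒴 ⊆ ℬ is invariant: 𝒴 = T^{−1}𝒴. Then the following are equivalent: (1) (Ω, ℬ, P, T) is conditionally weak mixing relative to 𝒴; (2) for every finite decision space U and every bounded measurable loss function ℓ : U × Ω → ℝ, there exists a weakly pathwise optimal admissible strategy. -/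
open MeasureTheory Filter Set
open scoped ENNReal Topology symmDiff

noncomputable section

namespace ErgodicDecisions

variable {Ω U : Type*}

variable {m0 : MeasurableSpace Ω} [mU : MeasurableSpace U]

/-- The indicator function of a set as a real function. -/
abbrev ind {Ω : Type*} (A : Set Ω) : Ω → ℝ := A.indicator (fun _ => (1 : ℝ))

lemma ind_abs_le {Ω : Type*} (A : Set Ω) (ω : Ω) : |ind A ω| ≤ 1 := by
  by_cases h : ω ∈ A <;> simp [ind, h]

lemma integrable_of_abs_le {Ω : Type*} {m0 : MeasurableSpace Ω} {P : Measure Ω}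
    [IsProbabilityMeasure P] {f : Ω → ℝ} (hf : Measurable f) {C : ℝ}
    (hC : ∀ ω, |f ω| ≤ C) : Integrable f P :=
  Integrable.of_bound hf.aestronglyMeasurable C (Eventually.of_forall hC)

lemma integrable_bdd_mul {Ω : Type*} {m0 : MeasurableSpace Ω} {P : Measure Ω}
    {w F : Ω → ℝ} (hw : Measurable w) {C : ℝ}
    (hC : ∀ ω, |w ω| ≤ C) (hF : Integrable F P) : Integrable (fun ω => w ω * F ω) P :=
  hF.bdd_mul hw.aestronglyMeasurable (Eventually.of_forall hC)

lemma integrable_ind {Ω : Type*} {m0 : MeasurableSpace Ω} {P : Measure Ω}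
    [IsProbabilityMeasure P] {A : Set Ω} (hA : MeasurableSet A) : Integrable (ind A) P :=
  integrable_of_abs_le (measurable_const.indicator hA) (ind_abs_le A)

lemma integral_mul_condExp_eq {Ω : Type*} {Y m0 : MeasurableSpace Ω} {P : Measure Ω}
    [IsProbabilityMeasure P] (hY : Y ≤ m0) {w F : Ω → ℝ} (hw : Measurable[Y] w) {C : ℝ}
    (hC : ∀ ω, |w ω| ≤ C) (hF : Integrable F P) :
    ∫ ω, w ω * F ω ∂P = ∫ ω, w ω * (P[F | Y]) ω ∂P := by
  have h := condExp_stronglyMeasurable_mul_of_bound hY (μ := P) hw.stronglyMeasurable hF C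
    (Eventually.of_forall hC)
  have h2 := integral_congr_ae h
  rw [integral_condExp hY] at h2
  exact h2

lemma integral_comp_mp {Ω : Type*} {m0 : MeasurableSpace Ω} {P : Measure Ω}
    {R : Ω → Ω} (hR : MeasurePreserving R P P) {f : Ω → ℝ} (hf : AEStronglyMeasurable f P) :
    ∫ ω, f (R ω) ∂P = ∫ ω, f ω ∂P := by
  conv_rhs => rw [← hR.map_eq]
  rw [integral_map hR.measurable.aemeasurable]
  rwa [hR.map_eq]

/-- A bounded version of the conditional probability. -/
lemma exists_version {Ω : Type*} {Y m0 : MeasurableSpace Ω} {P : Measure Ω}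
    [IsProbabilityMeasure P] (hY : Y ≤ m0) {A : Set Ω} (hA : MeasurableSet A) :
    ∃ p : Ω → ℝ, Measurable[Y] p ∧ (∀ ω, 0 ≤ p ω) ∧ (∀ ω, p ω ≤ 1) ∧ p =ᵐ[P] P[ind A | Y] := by
  refine ⟨fun ω => max 0 (min 1 ((P[ind A | Y]) ω)), ?_, fun ω => le_max_left _ _,
    fun ω => max_le zero_le_one (min_le_left _ _), ?_⟩
  · have : Measurable[Y] (P[ind A | Y]) := stronglyMeasurable_condExp.measurable
    exact Measurable.max (@measurable_const _ _ _ Y _)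
      (Measurable.min (@measurable_const _ _ _ Y _) this)
  · have h0 : 0 ≤ᵐ[P] P[ind A | Y] := condExp_nonneg (Eventually.of_forall fun ω => by
      simp only [Pi.zero_apply, ind]; exact indicator_nonneg (fun _ _ => zero_le_one) _)
    have h1 : P[ind A | Y] ≤ᵐ[P] P[fun _ => (1 : ℝ) | Y] :=
      condExp_mono (integrable_ind hA) (integrable_const _)
        (Eventually.of_forall fun ω => (le_abs_self _).trans (ind_abs_le A ω))
    rw [condExp_const hY] at h1
    filter_upwards [h0, h1] with ω h0 h1
    simp only [Pi.zero_apply] at h0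
    rw [min_eq_right h1, max_eq_right h0]

/-- The conditional covariance of two sets. -/
def ccov {Ω : Type*} {m0 : MeasurableSpace Ω} (P : Measure Ω) (Y : MeasurableSpace Ω)
    (A B : Set Ω) (ω : Ω) : ℝ :=
  (P[ind (A ∩ B) | Y]) ω - (P[ind A | Y]) ω * (P[ind B | Y]) ω

lemma measurable_ccov {Ω : Type*} {Y m0 : MeasurableSpace Ω} (P : Measure Ω) (A B : Set Ω) :
    Measurable[Y] (ccov P Y A B) := by
  have h : ∀ C : Set Ω, Measurable[Y] (P[ind C | Y]) :=
    fun C => stronglyMeasurable_condExp.measurable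
  exact Measurable.sub (h _) (Measurable.mul (h _) (h _))

lemma integrable_ccov {Ω : Type*} {Y m0 : MeasurableSpace Ω} (P : Measure Ω)
    [IsProbabilityMeasure P] (hY : Y ≤ m0) {A B : Set Ω} (hA : MeasurableSet A) :
    Integrable (ccov P Y A B) P := by
  obtain ⟨p, hp, hp0, hp1, hpe⟩ := exists_version (P := P) hY hA
  have h1 : Integrable (fun ω => (P[ind (A ∩ B) | Y]) ω - p ω * (P[ind B | Y]) ω) P :=
    integrable_condExp.sub (integrable_bdd_mul (hp.mono hY le_rfl) (C := 1)
      (fun ω => abs_le.2 ⟨by linarith [hp0 ω], hp1 ω⟩) integrable_condExp)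
  refine h1.congr ?_
  filter_upwards [hpe] with ω h
  simp only [ccov, h]

lemma integral_centered {Ω : Type*} {Y m0 : MeasurableSpace Ω} {P : Measure Ω}
    [IsProbabilityMeasure P] (hY : Y ≤ m0) {A : Set Ω} (hA : MeasurableSet A)
    {p w : Ω → ℝ} (hp : Measurable[Y] p) (hp0 : ∀ ω, 0 ≤ p ω) (hp1 : ∀ ω, p ω ≤ 1)
    (hpe : p =ᵐ[P] P[ind A | Y]) (hw : Measurable[Y] w) {C : ℝ} (hC : ∀ ω, |w ω| ≤ C) :
    ∫ ω, w ω * (ind A ω - p ω) ∂P = 0 := by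
  have hpb : ∀ ω, |p ω| ≤ 1 := fun ω => abs_le.2 ⟨by linarith [hp0 ω], hp1 ω⟩
  have e : ∀ ω, w ω * (ind A ω - p ω) = w ω * ind A ω - w ω * p ω := fun ω => by ring
  simp_rw [e]
  rw [integral_sub (integrable_bdd_mul (hw.mono hY le_rfl) hC (integrable_ind hA))
    (integrable_bdd_mul (hw.mono hY le_rfl) hC (integrable_of_abs_le (hp.mono hY le_rfl) hpb)),
    integral_mul_condExp_eq hY hw hC (integrable_ind hA), sub_eq_zero]
  apply integral_congr_ae
  filter_upwards [hpe] with ω h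
  rw [h]

lemma integral_centered_ind {Ω : Type*} {Y m0 : MeasurableSpace Ω} {P : Measure Ω}
    [IsProbabilityMeasure P] (hY : Y ≤ m0) {A B : Set Ω} (hA : MeasurableSet A)
    (hB : MeasurableSet B)
    {p w : Ω → ℝ} (hp : Measurable[Y] p) (hp0 : ∀ ω, 0 ≤ p ω) (hp1 : ∀ ω, p ω ≤ 1)
    (hpe : p =ᵐ[P] P[ind A | Y]) (hw : Measurable[Y] w) {C : ℝ} (hC : ∀ ω, |w ω| ≤ C) :
    ∫ ω, w ω * ((ind A ω - p ω) * ind B ω) ∂P = ∫ ω, w ω * ccov P Y A B ω ∂P := by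
  have hpb : ∀ ω, |p ω| ≤ 1 := fun ω => abs_le.2 ⟨by linarith [hp0 ω], hp1 ω⟩
  have e : ∀ ω, w ω * ((ind A ω - p ω) * ind B ω) =
      w ω * ind (A ∩ B) ω - (w ω * p ω) * ind B ω := fun ω => by
    by_cases h1 : ω ∈ A <;> by_cases h2 : ω ∈ B <;> (simp [ind, h1, h2]; try ring)
  have hwp : Measurable[Y] (fun ω => w ω * p ω) := Measurable.mul hw hp
  have hwpb : ∀ ω, |w ω * p ω| ≤ C := fun ω => by
    rw [abs_mul]
    have := mul_le_mul (hC ω) (hpb ω) (abs_nonneg _) ((abs_nonneg _).trans (hC ω))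
    simpa using this
  simp_rw [e]
  rw [integral_sub (integrable_bdd_mul (hw.mono hY le_rfl) hC (integrable_ind (hA.inter hB)))
    (integrable_bdd_mul (hwp.mono hY le_rfl) hwpb (integrable_ind hB)),
    integral_mul_condExp_eq hY hw hC (integrable_ind (hA.inter hB)),
    integral_mul_condExp_eq hY hwp hwpb (integrable_ind hB),
    ← integral_sub (integrable_bdd_mul (hw.mono hY le_rfl) hC integrable_condExp)
    (integrable_bdd_mul (hwp.mono hY le_rfl) hwpb integrable_condExp)]
  apply integral_congr_ae
  filter_upwards [hpe] with ω h
  simp only [ccov, h]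
  ring

/-- Correlation bound. -/
lemma corr_bound {Ω : Type*} {Y m0 : MeasurableSpace Ω} {P : Measure Ω}
    [IsProbabilityMeasure P] (hY : Y ≤ m0) {S : Ω → Ω} (hS : MeasurePreserving S P P)
    (hSY : Measurable[Y, Y] S) {A : Set Ω} (hA : MeasurableSet A)
    {p w : Ω → ℝ} (hp : Measurable[Y] p) (hp0 : ∀ ω, 0 ≤ p ω) (hp1 : ∀ ω, p ω ≤ 1)
    (hpe : p =ᵐ[P] P[ind A | Y]) (hw : Measurable[Y] w) (hC : ∀ ω, |w ω| ≤ 1) (d : ℕ) :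
    |∫ ω, w ω * ((ind A ω - p ω) * (ind A (S^[d] ω) - p (S^[d] ω))) ∂P| ≤
      ∫ ω, |ccov P Y A (S^[d] ⁻¹' A) ω| ∂P := by
  have hpb : ∀ ω, |p ω| ≤ 1 := fun ω => abs_le.2 ⟨by linarith [hp0 ω], hp1 ω⟩
  have hSd : Measurable[Y, Y] (S^[d]) := hSY.iterate d
  have hSd0 : Measurable (S^[d]) := hS.measurable.iterate d
  have hB : MeasurableSet (S^[d] ⁻¹' A) := hSd0 hA
  have e : ∀ ω, w ω * ((ind A ω - p ω) * (ind A (S^[d] ω) - p (S^[d] ω))) =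
      w ω * ((ind A ω - p ω) * ind (S^[d] ⁻¹' A) ω) -
        (w ω * p (S^[d] ω)) * (ind A ω - p ω) := fun ω => by
    have : ind (S^[d] ⁻¹' A) ω = ind A (S^[d] ω) := rfl
    rw [this]; ring
  have hq : Measurable[Y] (fun ω => w ω * p (S^[d] ω)) := Measurable.mul hw (hp.comp hSd)
  have hqb : ∀ ω, |w ω * p (S^[d] ω)| ≤ 1 := fun ω => by
    rw [abs_mul]
    exact mul_le_one₀ (hC ω) (abs_nonneg _) (hpb _)
  have hApm : Measurable (fun ω => ind A ω - p ω) :=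
    (measurable_const.indicator hA).sub (hp.mono hY le_rfl)
  have hApb : ∀ ω, |ind A ω - p ω| ≤ 2 := fun ω =>
    (abs_sub _ _).trans (by linarith [ind_abs_le A ω, hpb ω])
  have hAp : Integrable (fun ω => ind A ω - p ω) P := integrable_of_abs_le hApm hApb
  simp_rw [e]
  rw [integral_sub (integrable_bdd_mul (hw.mono hY le_rfl) hC
      (integrable_bdd_mul hApm hApb (integrable_ind hB)))
    (integrable_bdd_mul (hq.mono hY le_rfl) hqb hAp),
    integral_centered hY hA hp hp0 hp1 hpe hq hqb, sub_zero,
    integral_centered_ind hY hA hB hp hp0 hp1 hpe hw hC]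
  refine (abs_integral_le_integral_abs).trans ?_
  refine integral_mono (integrable_bdd_mul (hw.mono hY le_rfl) hC
    (integrable_ccov P hY hA)).abs (integrable_ccov P hY hA).abs fun ω => ?_
  simp only [abs_mul]
  exact mul_le_of_le_one_left (abs_nonneg _) (hC ω)

lemma second_moment {Ω : Type*} {m0 : MeasurableSpace Ω} {P : Measure Ω}
    [IsProbabilityMeasure P] {x : ℕ → Ω → ℝ} {c : ℕ → ℝ} (hx : ∀ k, Measurable (x k))
    (hb : ∀ k ω, |x k ω| ≤ 1) (hc : ∀ d, 0 ≤ c d)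
    (hxc : ∀ j k, j < k → ∫ ω, x j ω * x k ω ∂P ≤ c (k - j)) (n : ℕ) :
    ∫ ω, (∑ k ∈ Finset.Icc 1 n, x k ω) ^ 2 ∂P ≤ n * (1 + 2 * ∑ d ∈ Finset.Icc 1 n, c d) := by
  have hxi : ∀ j k, Integrable (fun ω => x j ω * x k ω) P := fun j k =>
    integrable_bdd_mul (hx j) (hb j) (integrable_of_abs_le (hx k) (hb k))
  induction n with
  | zero => simp
  | succ n ih =>
    have e : ∀ ω, (∑ k ∈ Finset.Icc 1 (n + 1), x k ω) ^ 2 =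
        (∑ k ∈ Finset.Icc 1 n, x k ω) ^ 2 + (2 * ∑ k ∈ Finset.Icc 1 n, x k ω * x (n + 1) ω +
          x (n + 1) ω * x (n + 1) ω) := fun ω => by
      rw [Finset.sum_Icc_succ_top (by omega), ← Finset.sum_mul]; ring
    have i1 : Integrable (fun ω => ∑ k ∈ Finset.Icc 1 n, x k ω * x (n + 1) ω) P :=
      integrable_finsetSum _ fun k _ => hxi _ _
    have i0 : Integrable (fun ω => (∑ k ∈ Finset.Icc 1 n, x k ω) ^ 2) P := by
      have : ∀ ω, (∑ k ∈ Finset.Icc 1 n, x k ω) ^ 2 =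
          ∑ j ∈ Finset.Icc 1 n, ∑ k ∈ Finset.Icc 1 n, x j ω * x k ω := fun ω => by
        rw [sq, Finset.sum_mul_sum]
      simp_rw [this]
      exact integrable_finsetSum _ fun k _ => integrable_finsetSum _ fun k _ => hxi _ _
    have i2 : Integrable (fun ω => 2 * ∑ k ∈ Finset.Icc 1 n, x k ω * x (n + 1) ω +
        x (n + 1) ω * x (n + 1) ω) P := (i1.const_mul 2).add (hxi _ _)
    simp_rw [e]
    rw [integral_add i0 i2, integral_add (i1.const_mul 2) (hxi _ _),
      integral_const_mul, integral_finsetSum _ fun k _ => hxi _ _]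
    have h1 : ∫ ω, x (n + 1) ω * x (n + 1) ω ∂P ≤ 1 := by
      have : ∫ ω, x (n + 1) ω * x (n + 1) ω ∂P ≤ ∫ _, (1 : ℝ) ∂P := by
        refine integral_mono (hxi _ _) (integrable_const _) fun ω => ?_
        have := abs_le.1 (hb (n + 1) ω)
        simp only
        nlinarith
      simpa using this
    have h2 : ∑ k ∈ Finset.Icc 1 n, ∫ ω, x k ω * x (n + 1) ω ∂P ≤ ∑ d ∈ Finset.Icc 1 n, c d := by
      have : ∑ k ∈ Finset.Icc 1 n, c (n + 1 - k) = ∑ d ∈ Finset.Icc 1 n, c d := by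
        refine Finset.sum_bij' (fun k _ => n + 1 - k) (fun k _ => n + 1 - k) ?_ ?_ ?_ ?_ ?_
        all_goals intro k hk; simp only [Finset.mem_Icc] at hk ⊢
        all_goals omega
      rw [← this]
      exact Finset.sum_le_sum fun k hk => hxc _ _ (by simp only [Finset.mem_Icc] at hk; omega)
    rw [Finset.sum_Icc_succ_top (by omega) c]
    have h3 := hc (n + 1)
    have h4 : (0 : ℝ) ≤ n := Nat.cast_nonneg n
    have h5 := mul_nonneg h4 h3
    push_cast
    nlinarith

lemma tendsto_abs_of_sq {Ω : Type*} {m0 : MeasurableSpace Ω} {P : Measure Ω}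
    [IsProbabilityMeasure P] {X : ℕ → Ω → ℝ} (hX : ∀ n, Integrable (X n) P)
    (hX2 : ∀ n, Integrable (fun ω => X n ω ^ 2) P)
    (h : Tendsto (fun n => ∫ ω, X n ω ^ 2 ∂P) atTop (𝓝 0)) :
    Tendsto (fun n => ∫ ω, |X n ω| ∂P) atTop (𝓝 0) := by
  have h' := (Real.continuous_sqrt.tendsto 0).comp h
  rw [Real.sqrt_zero] at h'
  refine squeeze_zero (fun n => integral_nonneg fun ω => abs_nonneg _) (fun n => ?_) h'
  simp only [Function.comp]
  refine Real.le_sqrt_of_sq_le ?_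
  set m := ∫ ω, |X n ω| ∂P
  have : 0 ≤ ∫ ω, (|X n ω| - m) ^ 2 ∂P := integral_nonneg fun ω => sq_nonneg _
  have e : ∀ ω, (|X n ω| - m) ^ 2 = X n ω ^ 2 - (2 * m) * |X n ω| + m ^ 2 := fun ω => by
    rw [← sq_abs (X n ω)]; ring
  simp_rw [e] at this
  have i2 : Integrable (fun ω => X n ω ^ 2 - (2 * m) * |X n ω|) P :=
    (hX2 n).sub ((hX n).abs.const_mul _)
  rw [integral_add i2 (integrable_const _),
    integral_sub (hX2 n) ((hX n).abs.const_mul _), integral_const_mul] at this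
  simp at this
  change 0 ≤ _ - 2 * m * m + m ^ 2 at this
  nlinarith

lemma avg_tendsto_zero {Ω : Type*} {m0 : MeasurableSpace Ω} {P : Measure Ω}
    [IsProbabilityMeasure P] {x : ℕ → Ω → ℝ} {c : ℕ → ℝ} (hx : ∀ k, Measurable (x k))
    (hb : ∀ k ω, |x k ω| ≤ 1) (hc : ∀ d, 0 ≤ c d)
    (hxc : ∀ j k, j < k → ∫ ω, x j ω * x k ω ∂P ≤ c (k - j))
    (hlim : Tendsto (fun n : ℕ => (n : ℝ)⁻¹ * ∑ d ∈ Finset.Icc 1 n, c d) atTop (𝓝 0)) :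
    Tendsto (fun n : ℕ => ∫ ω, |(n : ℝ)⁻¹ * ∑ k ∈ Finset.Icc 1 n, x k ω| ∂P) atTop (𝓝 0) := by
  have hm : ∀ n : ℕ, Measurable (fun ω => (n : ℝ)⁻¹ * ∑ k ∈ Finset.Icc 1 n, x k ω) := fun n =>
    (Finset.measurable_fun_sum _ fun k _ => hx k).const_mul _
  have hbd : ∀ (n : ℕ) ω, |(n : ℝ)⁻¹ * ∑ k ∈ Finset.Icc 1 n, x k ω| ≤ 1 := fun n ω => by
    rw [abs_mul, abs_of_nonneg (by positivity : (0 : ℝ) ≤ (n : ℝ)⁻¹)]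
    have h1 : |∑ k ∈ Finset.Icc 1 n, x k ω| ≤ n :=
      (Finset.abs_sum_le_sum_abs _ _).trans
        ((Finset.sum_le_sum fun k _ => hb k ω).trans (by simp))
    exact (mul_le_mul_of_nonneg_left h1 (by positivity)).trans inv_mul_le_one
  refine tendsto_abs_of_sq (fun n => integrable_of_abs_le (hm n) (hbd n))
    (fun n => integrable_of_abs_le ((hm n).pow_const 2) (C := 1) fun ω => ?_) ?_
  · rw [abs_pow]; exact pow_le_one₀ (abs_nonneg _) (hbd n ω)
  have hl : Tendsto (fun n : ℕ => (n : ℝ)⁻¹ + 2 * ((n : ℝ)⁻¹ * ∑ d ∈ Finset.Icc 1 n, c d))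
      atTop (𝓝 0) := by
    have := tendsto_inv_atTop_nhds_zero_nat (𝕜 := ℝ) |>.add (hlim.const_mul 2)
    simpa using this
  refine squeeze_zero (fun n => integral_nonneg fun ω => sq_nonneg _) (fun n => ?_) hl
  simp_rw [mul_pow]
  rw [integral_const_mul]
  refine (mul_le_mul_of_nonneg_left (second_moment hx hb hc hxc n) (by positivity)).trans ?_
  rcases Nat.eq_zero_or_pos n with rfl | hn
  · simp
  · have : (n : ℝ) ≠ 0 := by positivity
    apply le_of_eq
    field_simp

/-- Deviation functional. -/
def dev {Ω : Type*} {m0 : MeasurableSpace Ω} (P : Measure Ω) (T : Ω → Ω) (Y : MeasurableSpace Ω)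
    (a : ℕ → Ω → ℝ) (f : Ω → ℝ) (n : ℕ) (ω : Ω) : ℝ :=
  (n : ℝ)⁻¹ * ∑ k ∈ Finset.Icc 1 n, a k ω * (f (T^[k] ω) - (P[f | Y]) (T^[k] ω))

lemma dev_indicator {Ω : Type*} {Y m0 : MeasurableSpace Ω} {P : Measure Ω}
    [IsProbabilityMeasure P] (hY : Y ≤ m0) {T S : Ω → Ω} (hT : MeasurePreserving T P P)
    (hS : MeasurePreserving S P P) (hTS : Function.RightInverse S T)
    (hSY : Measurable[Y, Y] S)
    (hmix : CondWeakMixing P S Y) {a : ℕ → Ω → ℝ} (ha : ∀ k, Measurable[Y] (a k))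
    (hab : ∀ k ω, |a k ω| ≤ 1) {A : Set Ω} (hA : MeasurableSet A) :
    Tendsto (fun n => ∫ ω, |dev P T Y a (ind A) n ω| ∂P) atTop (𝓝 0) := by
  obtain ⟨p, hp, hp0, hp1, hpe⟩ := exists_version (P := P) hY hA
  have hTk : ∀ k, MeasurePreserving (T^[k]) P P := fun k => hT.iterate k
  have hSk : ∀ k, MeasurePreserving (S^[k]) P P := fun k => hS.iterate k
  have hApm : Measurable (fun ω => ind A ω - p ω) :=
    (measurable_const.indicator hA).sub (hp.mono hY le_rfl)
  have hApb : ∀ ω, |ind A ω - p ω| ≤ 1 := fun ω => by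
    rw [abs_le]
    have h0 := hp0 ω
    have h1 := hp1 ω
    by_cases h : ω ∈ A <;> simp [ind, h] <;> (try constructor) <;> linarith
  have hxm : ∀ k, Measurable (fun ω => a k ω * (ind A (T^[k] ω) - p (T^[k] ω))) := fun k =>
    ((ha k).mono hY le_rfl).mul (hApm.comp (hTk k).measurable)
  have key : Tendsto (fun n : ℕ => ∫ ω, |(n : ℝ)⁻¹ * ∑ k ∈ Finset.Icc 1 n,
      a k ω * (ind A (T^[k] ω) - p (T^[k] ω))| ∂P) atTop (𝓝 0) := by
    refine avg_tendsto_zero (c := fun d => ∫ ω, |ccov P Y A (S^[d] ⁻¹' A) ω| ∂P)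
      hxm (fun k ω => ?_)
      (fun d => integral_nonneg fun ω => abs_nonneg _) (fun j k hjk => ?_) ?_
    · rw [abs_mul]
      exact mul_le_one₀ (hab k ω) (abs_nonneg _) (hApb _)
    · have hm := (hxm j).mul (hxm k)
      have h1 := integral_comp_mp (hSk k) (hm.aestronglyMeasurable (μ := P))
      simp only [Pi.mul_apply] at h1
      rw [← h1]
      have hTSk : ∀ ω, T^[k] (S^[k] ω) = ω := fun ω => hTS.iterate k ω
      have hTSj : ∀ ω, T^[j] (S^[k] ω) = S^[k - j] ω := fun ω => by
        have : k = j + (k - j) := by omega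
        conv_lhs => rw [this, Function.iterate_add_apply]
        exact hTS.iterate j _
      simp_rw [hTSk, hTSj]
      refine (le_abs_self _).trans (le_trans (le_of_eq ?_) (corr_bound hY hS hSY hA hp hp0 hp1 hpe
        (w := fun ω => a j (S^[k] ω) * a k (S^[k] ω)) ?_ ?_ (k - j)))
      · congr 2; ext ω; ring
      · exact Measurable.mul ((ha j).comp (hSY.iterate k)) ((ha k).comp (hSY.iterate k))
      · intro ω
        rw [abs_mul]
        exact mul_le_one₀ (hab _ _) (abs_nonneg _) (hab _ _)
    · have := hmix A A hA hA
      refine this.congr fun n => ?_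
      rw [integral_const_mul, integral_finsetSum]
      · rfl
      · exact fun k _ => (integrable_ccov P hY hA).abs
  refine key.congr fun n => integral_congr_ae ?_
  have hall : ∀ᵐ ω ∂P, ∀ k, p (T^[k] ω) = (P[ind A | Y]) (T^[k] ω) :=
    ae_all_iff.2 fun k => (hTk k).quasiMeasurePreserving.ae_eq_comp hpe
  filter_upwards [hall] with ω h
  simp only [dev, h]

lemma integrable_dev {Ω : Type*} {Y m0 : MeasurableSpace Ω} {P : Measure Ω}
    [IsProbabilityMeasure P] (hY : Y ≤ m0) {T : Ω → Ω} (hT : MeasurePreserving T P P)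
    {a : ℕ → Ω → ℝ} (ha : ∀ k, Measurable[Y] (a k))
    (hab : ∀ k ω, |a k ω| ≤ 1) {f : Ω → ℝ} (hf : Integrable f P) (n : ℕ) :
    Integrable (dev P T Y a f n) P := by
  have hi : Integrable (fun ω => f ω - (P[f | Y]) ω) P := hf.sub integrable_condExp
  exact (integrable_finsetSum _ fun k _ => integrable_bdd_mul ((ha k).mono hY le_rfl) (hab k)
    ((hT.iterate k).integrable_comp_of_integrable hi)).const_mul _

lemma dev_le {Ω : Type*} {Y m0 : MeasurableSpace Ω} {P : Measure Ω}
    [IsProbabilityMeasure P] (hY : Y ≤ m0) {T : Ω → Ω} (hT : MeasurePreserving T P P)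
    {a : ℕ → Ω → ℝ} (ha : ∀ k, Measurable[Y] (a k))
    (hab : ∀ k ω, |a k ω| ≤ 1) {f : Ω → ℝ} (hf : Integrable f P) (n : ℕ) :
    ∫ ω, |dev P T Y a f n ω| ∂P ≤ 2 * ∫ ω, |f ω| ∂P := by
  have hi : Integrable (fun ω => f ω - (P[f | Y]) ω) P := hf.sub integrable_condExp
  have hik : ∀ k, Integrable (fun ω => f (T^[k] ω) - (P[f | Y]) (T^[k] ω)) P := fun k =>
    (hT.iterate k).integrable_comp_of_integrable hi
  set I := ∫ ω, |f ω - (P[f | Y]) ω| ∂P with hI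
  have hI2 : I ≤ 2 * ∫ ω, |f ω| ∂P := by
    have h1 : I ≤ ∫ ω, (|f ω| + |(P[f | Y]) ω|) ∂P :=
      integral_mono hi.abs (hf.abs.add integrable_condExp.abs) fun ω => abs_sub _ _
    rw [integral_add hf.abs integrable_condExp.abs] at h1
    have h2 := integral_abs_condExp_le (m := Y) (μ := P) f
    linarith
  have hIk : ∀ k, ∫ ω, |f (T^[k] ω) - (P[f | Y]) (T^[k] ω)| ∂P = I := fun k =>
    integral_comp_mp (hT.iterate k) hi.abs.aestronglyMeasurable
  have hI0 : 0 ≤ I := integral_nonneg fun ω => abs_nonneg _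
  have step : ∫ ω, |dev P T Y a f n ω| ∂P ≤
      ∫ ω, (n : ℝ)⁻¹ * ∑ k ∈ Finset.Icc 1 n, |f (T^[k] ω) - (P[f | Y]) (T^[k] ω)| ∂P := by
    refine integral_mono (integrable_dev hY hT ha hab hf n).abs
      ((integrable_finsetSum _ fun k _ => (hik k).abs).const_mul _) fun ω => ?_
    simp only [dev]
    rw [abs_mul, abs_of_nonneg (by positivity : (0 : ℝ) ≤ (n : ℝ)⁻¹)]
    refine mul_le_mul_of_nonneg_left ((Finset.abs_sum_le_sum_abs _ _).trans
      (Finset.sum_le_sum fun k _ => ?_)) (by positivity)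
    rw [abs_mul]
    exact mul_le_of_le_one_left (abs_nonneg _) (hab k ω)
  rw [integral_const_mul, integral_finsetSum _ fun k _ => (hik k).abs] at step
  simp_rw [hIk] at step
  simp only [Finset.sum_const, Nat.card_Icc, nsmul_eq_mul, Nat.add_sub_cancel] at step
  rw [← mul_assoc] at step
  exact (step.trans (mul_le_of_le_one_left hI0 inv_mul_le_one)).trans hI2

lemma dev_add {Ω : Type*} {Y m0 : MeasurableSpace Ω} {P : Measure Ω}
    {T : Ω → Ω} (hT : MeasurePreserving T P P)
    (a : ℕ → Ω → ℝ) {f g : Ω → ℝ} (hf : Integrable f P) (hg : Integrable g P) (n : ℕ) :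
    ∀ᵐ ω ∂P, dev P T Y a (f + g) n ω = dev P T Y a f n ω + dev P T Y a g n ω := by
  have hall : ∀ᵐ ω ∂P, ∀ k, (P[f + g | Y]) (T^[k] ω) = (P[f | Y] + P[g | Y]) (T^[k] ω) :=
    ae_all_iff.2 fun k => (hT.iterate k).quasiMeasurePreserving.ae_eq_comp (condExp_add hf hg Y)
  filter_upwards [hall] with ω h
  simp only [dev, h, Pi.add_apply]
  rw [← mul_add, ← Finset.sum_add_distrib]
  congr 1
  exact Finset.sum_congr rfl fun k _ => by ring

lemma dev_add_le {Ω : Type*} {Y m0 : MeasurableSpace Ω} {P : Measure Ω}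
    [IsProbabilityMeasure P] (hY : Y ≤ m0) {T : Ω → Ω} (hT : MeasurePreserving T P P)
    {a : ℕ → Ω → ℝ} (ha : ∀ k, Measurable[Y] (a k))
    (hab : ∀ k ω, |a k ω| ≤ 1) {f g : Ω → ℝ} (hf : Integrable f P) (hg : Integrable g P) (n : ℕ) :
    ∫ ω, |dev P T Y a (f + g) n ω| ∂P ≤
      ∫ ω, |dev P T Y a f n ω| ∂P + ∫ ω, |dev P T Y a g n ω| ∂P := by
  rw [← integral_add (integrable_dev hY hT ha hab hf n).abs (integrable_dev hY hT ha hab hg n).abs]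
  refine integral_mono_ae (integrable_dev hY hT ha hab (hf.add hg) n).abs
    ((integrable_dev hY hT ha hab hf n).abs.add (integrable_dev hY hT ha hab hg n).abs) ?_
  filter_upwards [dev_add (Y := Y) hT a hf hg n] with ω h
  simp only [h]
  exact abs_add_le _ _

lemma dev_approx {Ω : Type*} {Y m0 : MeasurableSpace Ω} {P : Measure Ω}
    [IsProbabilityMeasure P] (hY : Y ≤ m0) {T : Ω → Ω} (hT : MeasurePreserving T P P)
    {a : ℕ → Ω → ℝ} (ha : ∀ k, Measurable[Y] (a k))
    (hab : ∀ k ω, |a k ω| ≤ 1) {f g : Ω → ℝ} (hf : Integrable f P) (hg : Integrable g P) (n : ℕ) :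
    ∫ ω, |dev P T Y a f n ω| ∂P ≤
      ∫ ω, |dev P T Y a g n ω| ∂P + 2 * ∫ ω, |f ω - g ω| ∂P := by
  have h := dev_add_le hY hT ha hab hg (hf.sub hg) n
  rw [add_sub_cancel] at h
  have := dev_le hY hT ha hab (hf.sub hg) n
  simp only [Pi.sub_apply] at this
  linarith

lemma dev_tendsto {Ω : Type*} {Y m0 : MeasurableSpace Ω} {P : Measure Ω}
    [IsProbabilityMeasure P] (hY : Y ≤ m0) {T S : Ω → Ω} (hT : MeasurePreserving T P P)
    (hS : MeasurePreserving S P P) (hTS : Function.RightInverse S T)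
    (hSY : Measurable[Y, Y] S)
    (hmix : CondWeakMixing P S Y) {a : ℕ → Ω → ℝ} (ha : ∀ k, Measurable[Y] (a k))
    (hab : ∀ k ω, |a k ω| ≤ 1) {f : Ω → ℝ} (hf : Integrable f P) :
    Tendsto (fun n => ∫ ω, |dev P T Y a f n ω| ∂P) atTop (𝓝 0) := by
  have hnn : ∀ (f : Ω → ℝ) n, 0 ≤ ∫ ω, |dev P T Y a f n ω| ∂P := fun f n =>
    integral_nonneg fun ω => abs_nonneg _
  refine Integrable.induction (fun f => Tendsto (fun n => ∫ ω, |dev P T Y a f n ω| ∂P) atTop (𝓝 0))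
    ?_ ?_ ?_ ?_ hf
  · intro c s hs _
    have h := (dev_indicator hY hT hS hTS hSY hmix ha hab hs).const_mul |c|
    rw [mul_zero] at h
    refine h.congr fun n => ?_
    rw [← integral_const_mul]
    apply integral_congr_ae
    have e : (s.indicator fun _ => c) = c • ind s := by
      ext ω; by_cases h : ω ∈ s <;> simp [ind, h]
    have hall : ∀ᵐ ω ∂P, ∀ k, (P[c • ind s | Y]) (T^[k] ω) = (c • P[ind s | Y]) (T^[k] ω) :=
      ae_all_iff.2 fun k => (hT.iterate k).quasiMeasurePreserving.ae_eq_comp (condExp_smul c _ Y)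
    filter_upwards [hall] with ω h
    rw [← abs_mul, e]
    simp only [dev, h, Pi.smul_apply, smul_eq_mul]
    congr 1
    rw [mul_left_comm, Finset.mul_sum]
    congr 1
    exact Finset.sum_congr rfl fun k _ => by ring
  · intro f g _ hf hg h1 h2
    have h := h1.add h2
    rw [add_zero] at h
    exact squeeze_zero (hnn _) (dev_add_le hY hT ha hab hf hg) h
  · rw [← isSeqClosed_iff_isClosed]
    intro fs f hfs hlim
    rw [Set.mem_ofPred_eq, Metric.tendsto_atTop]
    intro ε hε
    obtain ⟨i, hi⟩ := (Metric.tendsto_atTop.1 hlim) (ε / 4) (by positivity)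
    have hi := hi i le_rfl
    obtain ⟨N, hN⟩ := (Metric.tendsto_atTop.1 (hfs i)) (ε / 4) (by positivity)
    refine ⟨N, fun n hn => ?_⟩
    have h1 := hN n hn
    rw [Real.dist_eq, sub_zero, abs_of_nonneg (hnn _ _)] at h1 ⊢
    have h2 := dev_approx hY hT ha hab (L1.integrable_coeFn f) (L1.integrable_coeFn (fs i)) n
    have h3 : ∫ ω, |f ω - fs i ω| ∂P < ε / 4 := by
      rw [dist_comm, dist_eq_norm, L1.norm_eq_integral_norm] at hi
      refine lt_of_eq_of_lt (integral_congr_ae ?_) hi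
      filter_upwards [Lp.coeFn_sub f (fs i)] with ω h
      rw [h, Pi.sub_apply, Real.norm_eq_abs]
    linarith
  · intro f g hfg hf h
    refine squeeze_zero (hnn _) (fun n => ?_) h
    have h2 := dev_approx hY hT ha hab (hf.congr hfg) hf n
    have h3 : ∫ ω, |g ω - f ω| ∂P = 0 := by
      rw [integral_eq_zero_of_ae]
      filter_upwards [hfg] with ω h
      simp [h]
    rw [h3] at h2
    linarith

lemma obsField_eq {Ω : Type*} {T S : Ω → Ω} {Y : MeasurableSpace Ω}
    (hYinv : MeasurableSpace.comap T Y = Y) (k : ℕ) : obsField T S Y 0 (k : ℤ) = Y := by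
  have hk : ∀ j : ℕ, MeasurableSpace.comap (T^[j]) Y = Y := fun j => by
    induction j with
    | zero => simp [MeasurableSpace.comap_id]
    | succ j ih => rw [Function.iterate_succ, ← MeasurableSpace.comap_comp, ih, hYinv]
  apply le_antisymm
  · refine iSup₂_le fun i hi => ?_
    obtain ⟨j, rfl⟩ := Int.eq_ofNat_of_zero_le hi.1
    exact (hk j).le
  · refine le_trans ?_ (le_iSup₂_of_le (0 : ℤ) ⟨le_rfl, by positivity⟩ le_rfl)
    exact (hk 0).ge

lemma exists_argmin {Ω U : Type*} [m : MeasurableSpace Ω] [Nonempty U] [Finite U]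
    (g : U → Ω → ℝ) (hg : ∀ a, Measurable (g a)) :
    ∃ v : Ω → U, Measurable[m, ⊤] v ∧ ∀ ω a, g (v ω) ω ≤ g a ω := by
  classical
  have := Fintype.ofFinite U
  have key : ∀ s : Finset U, ∃ v : Ω → U, Measurable[m, ⊤] v ∧
      Measurable (fun ω => g (v ω) ω) ∧ ∀ ω, ∀ a ∈ s, g (v ω) ω ≤ g a ω := by
    intro s
    induction s using Finset.induction_on with
    | empty =>
      exact ⟨fun _ => Classical.arbitrary U, @measurable_const _ _ ⊤ _ _, hg _, by simp⟩
    | insert b s _ ih =>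
      obtain ⟨v, hv, hgv, hmin⟩ := ih
      have hset : MeasurableSet {ω | g b ω ≤ g (v ω) ω} := measurableSet_le (hg b) hgv
      refine ⟨fun ω => if g b ω ≤ g (v ω) ω then b else v ω, ?_, ?_, ?_⟩
      · let _ : MeasurableSpace U := ⊤
        exact Measurable.ite hset measurable_const hv
      · have : (fun ω => g (if g b ω ≤ g (v ω) ω then b else v ω) ω) =
            fun ω => if g b ω ≤ g (v ω) ω then g b ω else g (v ω) ω := by
          ext ω; split_ifs <;> rfl
        rw [this]
        exact Measurable.ite hset (hg b) hgv
      · intro ω a ha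
        beta_reduce
        rcases Finset.mem_insert.1 ha with rfl | ha
        · split_ifs with h
          · exact le_rfl
          · exact (not_le.1 h).le
        · have := hmin ω a ha
          split_ifs with h
          · exact h.trans this
          · exact this
  obtain ⟨v, hv, _, h⟩ := key Finset.univ
  exact ⟨v, hv, fun ω a => h ω a (Finset.mem_univ a)⟩

lemma exists_repr (U : Type*) [mU : MeasurableSpace U] [Finite U] :
    ∃ r : U → U, Measurable[mU, ⊤] r ∧ ∀ u, ∀ s : Set U, MeasurableSet s → u ∈ s → r u ∈ s := by
  have hne : ∀ u : U, (measurableAtom u).Nonempty := fun u => ⟨u, mem_measurableAtom_self u⟩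
  let c : Set U → U → U := fun s u => by
    classical exact if h : s.Nonempty then h.some else u
  have hc : ∀ u : U, c (measurableAtom u) u ∈ measurableAtom u := fun u => by
    simp only [c, dif_pos (hne u)]; exact (hne u).some_mem
  have hc2 : ∀ u u' : U, u' ∈ measurableAtom u →
      c (measurableAtom u') u' = c (measurableAtom u) u := fun u u' h => by
    rw [measurableAtom_eq_of_mem h]
    simp only [c, dif_pos (hne u)]
  refine ⟨fun u => c (measurableAtom u) u, fun s _ => ?_, fun u s hs hu =>
    measurableAtom_subset hs hu (hc u)⟩
  have : (fun u => c (measurableAtom u) u) ⁻¹' s =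
      ⋃ u ∈ (fun u => c (measurableAtom u) u) ⁻¹' s, measurableAtom u := by
    ext x
    simp only [mem_preimage, mem_iUnion, exists_prop]
    constructor
    · exact fun h => ⟨x, h, mem_measurableAtom_self x⟩
    · rintro ⟨u, hu, hx⟩
      rwa [hc2 u x hx]
  rw [this]
  exact MeasurableSet.biUnion (Set.to_countable _) fun u _ =>
    MeasurableSet.measurableAtom_of_countable u

lemma forward {Ω : Type*} {Y m0 : MeasurableSpace Ω} {P : Measure Ω}
    [IsProbabilityMeasure P] (hY : Y ≤ m0) {T S : Ω → Ω} (hT : MeasurePreserving T P P)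
    (hS : MeasurePreserving S P P) (hTS : Function.RightInverse S T)
    (hSY : Measurable[Y, Y] S) (hTY : Measurable[Y, Y] T)
    (hYinv : MeasurableSpace.comap T Y = Y)
    (hmix : CondWeakMixing P S Y) (U : Type) [mU : MeasurableSpace U] [Nonempty U] [Finite U]
    (ℓ : U → Ω → ℝ) (hℓ : Measurable (fun p : U × Ω => ℓ p.1 p.2)) {C : ℝ}
    (hC : ∀ u ω, |ℓ u ω| ≤ C) :
    ∃ us : ℕ → Ω → U, WeaklyPathwiseOptimal P T S Y ℓ us := by
  classical
  have := Fintype.ofFinite U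
  have hℓm : ∀ a, Measurable (ℓ a) := fun a => hℓ.comp measurable_prodMk_left
  have hℓi : ∀ a, Integrable (ℓ a) P := fun a => integrable_of_abs_le (hℓm a) (hC a)
  obtain ⟨v, hv, hvmin⟩ := @exists_argmin Ω U Y _ _ (fun a => P[ℓ a | Y])
    (fun a => stronglyMeasurable_condExp.measurable)
  obtain ⟨r, hr, hrs⟩ := exists_repr U
  have hrℓ : ∀ u ω, ℓ (r u) ω = ℓ u ω := fun u ω =>
    hrs u {x | ℓ x ω = ℓ u ω}
      ((hℓ.comp measurable_prodMk_right) (measurableSet_singleton (ℓ u ω))) rfl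
  have hvk : ∀ k : ℕ, Measurable[Y, ⊤] (fun ω => v (T^[k] ω)) := fun k =>
    @Measurable.comp _ _ _ Y Y ⊤ _ _ hv (hTY.iterate k)
  refine ⟨fun k ω => v (T^[k] ω), fun k _ => ?_, fun u hu ε hε => ?_⟩
  · simp only [Umn, Set.mem_ofPred_eq]
    rw [obsField_eq hYinv]
    exact @Measurable.mono _ _ Y Y ⊤ mU _ (hvk k) le_rfl le_top
  -- the weights
  have huk : ∀ k : ℕ, 1 ≤ k → Measurable[Y, ⊤] (fun ω => r (u k ω)) := fun k hk => by
    have h := hu k hk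
    simp only [Umn, Set.mem_ofPred_eq] at h
    rw [obsField_eq hYinv] at h
    exact @Measurable.comp _ _ _ Y mU ⊤ _ _ hr h
  let c : U → ℕ → Ω → ℝ := fun a k ω => if 1 ≤ k then
    ind ((fun ω => r (u k ω)) ⁻¹' {a}) ω - ind ((fun ω => v (T^[k] ω)) ⁻¹' {a}) ω else 0
  have hcm : ∀ a k, Measurable[Y] (c a k) := fun a k => by
    by_cases hk : 1 ≤ k
    · simp only [c, if_pos hk]
      have h1 : MeasurableSet[Y] ((fun ω => r (u k ω)) ⁻¹' {a}) := huk k hk trivial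
      have h2 : MeasurableSet[Y] ((fun ω => v (T^[k] ω)) ⁻¹' {a}) := hvk k trivial
      exact Measurable.sub (Measurable.indicator (@measurable_const _ _ _ Y _) h1)
        (Measurable.indicator (@measurable_const _ _ _ Y _) h2)
    · simp only [c, if_neg hk]
      exact @measurable_const _ _ _ Y _
  have hcb : ∀ a k ω, |c a k ω| ≤ 1 := fun a k ω => by
    by_cases hk : 1 ≤ k
    · simp only [c, if_pos hk, ind, indicator]
      split_ifs <;> norm_num
    · simp [c, if_neg hk]
  have hlim : Tendsto (fun n => ∑ a, ∫ ω, |dev P T Y (c a) (ℓ a) n ω| ∂P) atTop (𝓝 0) := by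
    have := tendsto_finsetSum (Finset.univ : Finset U) fun a _ =>
      dev_tendsto hY hT hS hTS hSY hmix (hcm a) (hcb a) (hℓi a)
    simpa using this
  -- pointwise lower bound
  have hlow : ∀ n ω, -(∑ a, |dev P T Y (c a) (ℓ a) n ω|) ≤
      avgLoss T S ℓ u n ω - avgLoss T S ℓ (fun k ω => v (T^[k] ω)) n ω := by
    intro n ω
    have h1 : -(∑ a, |dev P T Y (c a) (ℓ a) n ω|) ≤ ∑ a, dev P T Y (c a) (ℓ a) n ω := by
      rw [← Finset.sum_neg_distrib]
      exact Finset.sum_le_sum fun a _ => neg_abs_le _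
    refine h1.trans ?_
    simp only [dev, avgLoss, lossAt]
    rw [← Finset.mul_sum, ← mul_sub, Finset.sum_comm, ← Finset.sum_sub_distrib]
    refine mul_le_mul_of_nonneg_left (Finset.sum_le_sum fun k hk => ?_) (by positivity)
    have hk1 : 1 ≤ k := (Finset.mem_Icc.1 hk).1
    have hit : iter T S (k : ℤ) ω = T^[k] ω := rfl
    have hsum : ∀ F : U → ℝ, ∑ a, c a k ω * F a = F (r (u k ω)) - F (v (T^[k] ω)) := fun F => by
      simp only [c, if_pos hk1, ind, indicator, mem_preimage, mem_singleton_iff, sub_mul,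
        Finset.sum_sub_distrib, ite_mul, one_mul, zero_mul, Finset.sum_ite_eq, Finset.mem_univ,
        if_true]
    rw [hsum (fun a => ℓ a (T^[k] ω) - (P[ℓ a | Y]) (T^[k] ω)), hit, hrℓ]
    have := hvmin (T^[k] ω) (r (u k ω))
    linarith
  -- Markov
  have hInt : ∀ n, Integrable (fun ω => ∑ a, |dev P T Y (c a) (ℓ a) n ω|) P := fun n =>
    integrable_finsetSum _ fun a _ => (integrable_dev hY hT (hcm a) (hcb a) (hℓi a) n).abs
  have hsub : ∀ n, 1 - ENNReal.ofReal ((∑ a, ∫ ω, |dev P T Y (c a) (ℓ a) n ω| ∂P) / ε) ≤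
      P {ω | -ε ≤ avgLoss T S ℓ u n ω - avgLoss T S ℓ (fun k ω => v (T^[k] ω)) n ω} := by
    intro n
    have hM := mul_meas_ge_le_integral_of_nonneg (μ := P)
      (Eventually.of_forall fun ω => Finset.sum_nonneg fun a _ => abs_nonneg _) (hInt n) ε
    rw [integral_finsetSum _ fun a _ =>
      (integrable_dev hY hT (hcm a) (hcb a) (hℓi a) n).abs] at hM
    rw [mul_comm, ← le_div_iff₀ hε] at hM
    have hM' := ENNReal.ofReal_le_ofReal hM
    rw [Measure.real, ENNReal.ofReal_toReal (measure_ne_top _ _)] at hM'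
    rw [tsub_le_iff_right]
    refine le_trans ?_ (add_le_add le_rfl hM')
    rw [← measure_univ (μ := P)]
    refine le_trans (measure_mono fun ω _ => ?_) (measure_union_le _ _)
    by_cases h : ε ≤ ∑ a, |dev P T Y (c a) (ℓ a) n ω|
    · exact Or.inr h
    · left
      have := hlow n ω
      simp only [mem_ofPred_eq]
      linarith
  have hl2 : Tendsto (fun n => 1 - ENNReal.ofReal
      ((∑ a, ∫ ω, |dev P T Y (c a) (ℓ a) n ω| ∂P) / ε)) atTop (𝓝 1) := by
    have h := ENNReal.tendsto_ofReal (hlim.div_const ε)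
    rw [zero_div, ENNReal.ofReal_zero] at h
    have h2 := ENNReal.Tendsto.sub (tendsto_const_nhds (x := (1 : ℝ≥0∞))) h
      (Or.inl ENNReal.one_ne_top)
    simpa using h2
  exact tendsto_of_tendsto_of_tendsto_of_le_of_le hl2 tendsto_const_nhds hsub
    (fun n => prob_le_one)

/-- The sign attached to a Boolean. -/
def bsgn (b : Bool) : ℝ := if b then 1 else -1

lemma bsgn_abs (b : Bool) : |bsgn b| = 1 := by cases b <;> simp [bsgn]

lemma abs_avg_le {n : ℕ} {x : ℕ → ℝ} (hx : ∀ k, |x k| ≤ 1) :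
    |(n : ℝ)⁻¹ * ∑ k ∈ Finset.Icc 1 n, x k| ≤ 1 := by
  rw [abs_mul, abs_of_nonneg (by positivity : (0 : ℝ) ≤ (n : ℝ)⁻¹)]
  have h1 : |∑ k ∈ Finset.Icc 1 n, x k| ≤ n :=
    (Finset.abs_sum_le_sum_abs _ _).trans
      ((Finset.sum_le_sum fun k _ => hx k).trans (by simp))
  exact (mul_le_mul_of_nonneg_left h1 (by positivity)).trans inv_mul_le_one

lemma tendsto_abs_of_lower {Ω : Type*} {m0 : MeasurableSpace Ω} {P : Measure Ω}
    [IsProbabilityMeasure P] {X : ℕ → Ω → ℝ} (hX : ∀ n, Measurable (X n))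
    (hb : ∀ n ω, |X n ω| ≤ 2) (h0 : ∀ n, ∫ ω, X n ω ∂P = 0)
    (h : ∀ ε : ℝ, 0 < ε → Tendsto (fun n => P {ω | -ε ≤ X n ω}) atTop (𝓝 1)) :
    Tendsto (fun n => ∫ ω, |X n ω| ∂P) atTop (𝓝 0) := by
  have hi : ∀ n, Integrable (X n) P := fun n => integrable_of_abs_le (hX n) (hb n)
  rw [Metric.tendsto_atTop]
  intro ε hε
  have h1 := (ENNReal.tendsto_toReal ENNReal.one_ne_top).comp (h (ε / 8) (by positivity))
  obtain ⟨N, hN⟩ := (Metric.tendsto_atTop.1 h1) (ε / 8) (by positivity)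
  refine ⟨N, fun n hn => ?_⟩
  have h2 := hN n hn
  rw [Real.dist_eq, sub_zero, abs_of_nonneg (integral_nonneg fun ω => abs_nonneg _)]
  rw [Real.dist_eq] at h2
  simp only [Function.comp, ENNReal.toReal_one] at h2
  set E := {ω | -(ε / 8) ≤ X n ω} with hE
  have hEm : MeasurableSet E := measurableSet_le measurable_const (hX n)
  have hle : ∀ ω, |X n ω| ≤ X n ω + (ε / 4 + 4 * ind Eᶜ ω) := fun ω => by
    have := abs_le.1 (hb n ω)
    by_cases hω : ω ∈ E
    · have h3 : -(ε / 8) ≤ X n ω := hω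
      simp only [ind, indicator, mem_compl_iff, hω, not_true_eq_false, if_false]
      rw [abs_le]; constructor <;> linarith
    · simp only [ind, indicator, mem_compl_iff, hω, not_false_eq_true, if_true]
      rw [abs_le]; constructor <;> linarith
  have i1 : Integrable (fun ω => 4 * ind Eᶜ ω) P := (integrable_ind hEm.compl).const_mul 4
  have i2 : Integrable (fun ω => ε / 4 + 4 * ind Eᶜ ω) P := (integrable_const _).add i1
  have h4 : ∫ ω, |X n ω| ∂P ≤ ∫ ω, (X n ω + (ε / 4 + 4 * ind Eᶜ ω)) ∂P :=
    integral_mono (hi n).abs ((hi n).add i2) hle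
  rw [integral_add (hi n) i2, integral_add (integrable_const _) i1, h0, integral_const_mul] at h4
  have h5 : ∫ ω, ind Eᶜ ω ∂P = 1 - (P E).toReal := by
    rw [show (∫ ω, ind Eᶜ ω ∂P) = P.real Eᶜ by
      simp only [ind]; rw [integral_indicator_const _ hEm.compl]; simp]
    rw [probReal_compl_eq_one_sub hEm]; rfl
  rw [h5] at h4
  simp at h4
  have := (abs_lt.1 h2).1
  linarith

lemma backward {Ω : Type*} {Y m0 : MeasurableSpace Ω} {P : Measure Ω}
    [IsProbabilityMeasure P] (hY : Y ≤ m0) {T S : Ω → Ω} (hT : MeasurePreserving T P P)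
    (hS : MeasurePreserving S P P) (hST : Function.LeftInverse S T)
    (hTS : Function.RightInverse S T)
    (hSY : Measurable[Y, Y] S) (hTY : Measurable[Y, Y] T)
    (hYinv : MeasurableSpace.comap T Y = Y)
    (hopt : ∀ ℓ : Bool → Ω → ℝ, Measurable (fun p : Bool × Ω => ℓ p.1 p.2) →
      (∃ C : ℝ, ∀ u ω, |ℓ u ω| ≤ C) → ∃ us : ℕ → Ω → Bool, WeaklyPathwiseOptimal P T S Y ℓ us) :
    CondWeakMixing P S Y := by
  classical
  intro A B hA hB
  obtain ⟨p, hp, hp0, hp1, hpe⟩ := exists_version (P := P) hY hA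
  set f : Ω → ℝ := fun ω => ind A ω - p ω with hf
  have hfm : Measurable f := (measurable_const.indicator hA).sub (hp.mono hY le_rfl)
  have hfb : ∀ ω, |f ω| ≤ 1 := fun ω => by
    rw [abs_le]
    have h0 := hp0 ω
    have h1 := hp1 ω
    by_cases h : ω ∈ A <;> simp [hf, ind, h] <;> (try constructor) <;> linarith
  have hTk : ∀ k, MeasurePreserving (T^[k]) P P := fun k => hT.iterate k
  have hSk : ∀ k, MeasurePreserving (S^[k]) P P := fun k => hS.iterate k
  obtain ⟨us, hus, husopt⟩ := hopt (fun b ω => bsgn b * f ω)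
    (((measurable_of_countable bsgn).comp measurable_fst).mul (hfm.comp measurable_snd))
    ⟨1, fun b ω => by rw [abs_mul, bsgn_abs, one_mul]; exact hfb ω⟩
  have hadm : ∀ u : ℕ → Ω → Bool, Admissible T S Y u ↔ ∀ k, 1 ≤ k → Measurable[Y] (u k) := by
    intro u
    simp only [Admissible, Umn, Set.mem_ofPred_eq]
    constructor
    · intro h k hk
      have := h k hk
      rwa [obsField_eq hYinv] at this
    · intro h k hk
      rw [obsField_eq hYinv]
      exact h k hk
  set L := fun (u : ℕ → Ω → Bool) (n : ℕ) ω => avgLoss T S (fun b ω => bsgn b * f ω) u n ω with hL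
  have hLeq : ∀ u n ω, L u n ω =
      (n : ℝ)⁻¹ * ∑ k ∈ Finset.Icc 1 n, bsgn (u k ω) * f (T^[k] ω) := fun u n ω => rfl
  have hLb : ∀ u n ω, |L u n ω| ≤ 1 := fun u n ω => by
    rw [hLeq]
    refine abs_avg_le fun k => ?_
    rw [abs_mul, bsgn_abs, one_mul]
    exact hfb _
  have hbm : ∀ u : Ω → Bool, Measurable[Y] u → Measurable[Y] (fun ω => bsgn (u ω)) := fun u hu =>
    (measurable_of_countable bsgn).comp hu
  have htm : ∀ (u : ℕ → Ω → Bool) k, Measurable[Y] (u k) →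
      Measurable (fun ω => bsgn (u k ω) * f (T^[k] ω)) := fun u k hu =>
    ((hbm _ hu).mono hY le_rfl).mul (hfm.comp (hTk k).measurable)
  have hLm : ∀ u, Admissible T S Y u → ∀ n, Measurable (L u n) := fun u hu n => by
    have : L u n = fun ω => (n : ℝ)⁻¹ * ∑ k ∈ Finset.Icc 1 n, bsgn (u k ω) * f (T^[k] ω) :=
      funext fun ω => hLeq u n ω
    rw [this]
    exact (Finset.measurable_fun_sum _ fun k hk =>
      htm u k ((hadm u).1 hu k (Finset.mem_Icc.1 hk).1)).const_mul _
  have hL0 : ∀ u, Admissible T S Y u → ∀ n, ∫ ω, L u n ω ∂P = 0 := fun u hu n => by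
    simp_rw [hLeq]
    have hukm : ∀ k ∈ Finset.Icc 1 n, Measurable[Y] (u k) := fun k hk =>
      (hadm u).1 hu k (Finset.mem_Icc.1 hk).1
    rw [integral_const_mul, integral_finsetSum]
    · rw [Finset.sum_eq_zero, mul_zero]
      intro k hk
      have h1 := integral_comp_mp (hSk k) ((htm u k (hukm k hk)).aestronglyMeasurable (μ := P))
      rw [← h1]
      have hTSk : ∀ ω, T^[k] (S^[k] ω) = ω := fun ω => hTS.iterate k ω
      simp_rw [hTSk]
      exact integral_centered hY hA hp hp0 hp1 hpe (C := 1)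
        (w := fun ω => bsgn (u k (S^[k] ω)))
        (hbm _ ((hukm k hk).comp (hSY.iterate k))) (fun ω => (bsgn_abs _).le)
    · intro k hk
      refine integrable_of_abs_le (htm u k (hukm k hk)) (C := 1) fun ω => ?_
      rw [abs_mul, bsgn_abs, one_mul]
      exact hfb _
  have hLi : ∀ u, Admissible T S Y u → ∀ n, Integrable (L u n) P := fun u hu n =>
    integrable_of_abs_le (hLm u hu n) (hLb u n)
  have hdiff : ∀ u, Admissible T S Y u →
      Tendsto (fun n => ∫ ω, |L u n ω - L us n ω| ∂P) atTop (𝓝 0) := fun u hu => by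
    refine tendsto_abs_of_lower (fun n => (hLm u hu n).sub (hLm us hus n)) (fun n ω => ?_)
      (fun n => ?_) (fun ε hε => husopt u hu ε hε)
    · exact (abs_sub _ _).trans (by linarith [hLb u n ω, hLb us n ω])
    · rw [integral_sub (hLi u hu n) (hLi us hus n), hL0 u hu, hL0 us hus, sub_zero]
  have hzero : ∀ u, Admissible T S Y u →
      Tendsto (fun n => ∫ ω, |L u n ω| ∂P) atTop (𝓝 0) := fun u hu => by
    let u' : ℕ → Ω → Bool := fun k ω => !(u k ω)
    have hu' : Admissible T S Y u' := (hadm u').2 fun k hk =>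
      (measurable_of_countable not).comp ((hadm u).1 hu k hk)
    have hneg : ∀ n ω, L u' n ω = - L u n ω := fun n ω => by
      rw [hLeq, hLeq, ← mul_neg, ← Finset.sum_neg_distrib]
      congr 1
      refine Finset.sum_congr rfl fun k _ => ?_
      simp only [u']
      cases u k ω <;> simp [bsgn]
    have h := (hdiff u hu).add (hdiff u' hu')
    rw [add_zero] at h
    refine squeeze_zero (fun n => integral_nonneg fun ω => abs_nonneg _) (fun n => ?_) h
    have i1 : Integrable (fun ω => |L u n ω - L us n ω|) P :=
      ((hLi u hu n).sub (hLi us hus n)).abs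
    have i2 : Integrable (fun ω => |L u' n ω - L us n ω|) P :=
      ((hLi u' hu' n).sub (hLi us hus n)).abs
    rw [← integral_add i1 i2]
    refine integral_mono (hLi u hu n).abs (i1.add i2) fun ω => ?_
    beta_reduce
    rw [hneg n ω]
    have h1 := abs_sub_abs_le_abs_sub (L u n ω) (L us n ω)
    have h2 := abs_sub (L u n ω - L us n ω) (-L u n ω - L us n ω)
    have h3 : L u n ω - L us n ω - (-L u n ω - L us n ω) = 2 * L u n ω := by ring
    rw [h3, abs_mul, abs_two] at h2
    linarith [abs_nonneg (L u n ω)]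
  -- choose the signs
  have hq : ∀ k, Measurable[Y] (ccov P Y A (S^[k] ⁻¹' B)) := fun k => measurable_ccov P _ _
  let s : ℕ → Ω → Bool := fun k ω => decide (0 ≤ ccov P Y A (S^[k] ⁻¹' B) ω)
  have hs : ∀ k, Measurable[Y] (s k) := fun k => by
    have h1 : MeasurableSet[Y] {ω | 0 ≤ ccov P Y A (S^[k] ⁻¹' B) ω} :=
      (hq k) measurableSet_Ici
    have h2 : s k = fun ω => if 0 ≤ ccov P Y A (S^[k] ⁻¹' B) ω then true else false := by
      ext ω; simp [s]
    rw [h2]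
    exact @Measurable.ite _ _ _ _ _ _ _ _ h1 (@measurable_const _ _ _ Y _)
      (@measurable_const _ _ _ Y _)
  have hsq : ∀ k ω, bsgn (s k ω) * ccov P Y A (S^[k] ⁻¹' B) ω =
      |ccov P Y A (S^[k] ⁻¹' B) ω| := fun k ω => by
    by_cases h : 0 ≤ ccov P Y A (S^[k] ⁻¹' B) ω
    · simp [s, bsgn, h, abs_of_nonneg h]
    · simp [s, bsgn, h, abs_of_neg (not_le.1 h)]
  let u : ℕ → Ω → Bool := fun k ω => s k (T^[k] ω)
  have hum : ∀ k, Measurable[Y] (u k) := fun k => (hs k).comp (hTY.iterate k)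
  have hu : Admissible T S Y u := (hadm u).2 fun k _ => hum k
  have hterm : ∀ k, ∫ ω, |ccov P Y A (S^[k] ⁻¹' B) ω| ∂P =
      ∫ ω, bsgn (u k ω) * f (T^[k] ω) * ind B ω ∂P := fun k => by
    have hBk : MeasurableSet (S^[k] ⁻¹' B) := (hSk k).measurable hB
    simp_rw [← hsq]
    rw [← integral_centered_ind hY hA hBk hp hp0 hp1 hpe (hbm _ (hs k)) (C := 1)
      (fun ω => (bsgn_abs _).le)]
    have hm : Measurable (fun ω => bsgn (s k ω) * ((ind A ω - p ω) * ind (S^[k] ⁻¹' B) ω)) :=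
      ((hbm _ (hs k)).mono hY le_rfl).mul (hfm.mul (measurable_const.indicator hBk))
    rw [← integral_comp_mp (hTk k) hm.aestronglyMeasurable]
    congr 1
    ext ω
    have e : ind (S^[k] ⁻¹' B) (T^[k] ω) = ind B ω := by
      have : ind (S^[k] ⁻¹' B) (T^[k] ω) = ind B (S^[k] (T^[k] ω)) := rfl
      rw [this, hST.iterate k ω]
    rw [e, ← mul_assoc]
  refine squeeze_zero (fun n => integral_nonneg fun ω => ?_) (fun n => ?_) (hzero u hu)
  · exact mul_nonneg (by positivity) (Finset.sum_nonneg fun k _ => abs_nonneg _)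
  · change ∫ ω, (n : ℝ)⁻¹ * ∑ k ∈ Finset.Icc 1 n, |ccov P Y A (S^[k] ⁻¹' B) ω| ∂P ≤ _
    rw [integral_const_mul, integral_finsetSum _ fun k _ => (integrable_ccov P hY hA).abs]
    simp_rw [hterm]
    have hBm : Measurable (ind B) := measurable_const.indicator hB
    rw [← integral_finsetSum, ← integral_const_mul]
    · have hInt : Integrable (fun ω => L u n ω * ind B ω) P :=
        integrable_bdd_mul (hLm u hu n) (hLb u n) (integrable_ind hB)
      have e : ∀ ω, (n : ℝ)⁻¹ * ∑ k ∈ Finset.Icc 1 n, bsgn (u k ω) * f (T^[k] ω) * ind B ω =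
          L u n ω * ind B ω := fun ω => by
        rw [hLeq, ← Finset.sum_mul, mul_assoc]
      simp_rw [e]
      refine integral_mono hInt (hLi u hu n).abs fun ω => ?_
      refine (le_abs_self _).trans ?_
      simp only [abs_mul]
      exact mul_le_of_le_one_right (abs_nonneg _) (ind_abs_le B ω)
    · intro k _
      refine integrable_bdd_mul (htm u k (hum k)) (C := 1) (fun ω => ?_) (integrable_ind hB)
      rw [abs_mul, bsgn_abs, one_mul]
      exact hfb _

/-- Theorem 2.16: for an ergodic system on a standard probability space with
invariant observation σ-field `𝒴 = T⁻¹𝒴`, conditional weak mixing relative to `𝒴` is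
equivalent to the existence of a weakly pathwise optimal strategy for every bounded loss with
finite decision space. -/
theorem statement7
    {Ω : Type*} [m0 : MeasurableSpace Ω] [StandardBorelSpace Ω]
    (P : Measure Ω) [IsProbabilityMeasure P]
    (T S : Ω → Ω) (hT : Ergodic T P) (hS : MeasurePreserving S P P)
    (hST : Function.LeftInverse S T) (hTS : Function.RightInverse S T)
    (Y : MeasurableSpace Ω) (hY : Y ≤ m0)
    (hYinv : MeasurableSpace.comap T Y = Y) :
    CondWeakMixing P S Y ↔
      ∀ (U : Type) (mU : MeasurableSpace U), Nonempty U → Finite U →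
        ∀ ℓ : U → Ω → ℝ,
          Measurable[mU.prod m0] (fun p : U × Ω => ℓ p.1 p.2) →
          (∃ C : ℝ, ∀ u ω, |ℓ u ω| ≤ C) →
          ∃ us : ℕ → Ω → U, WeaklyPathwiseOptimal P T S Y ℓ us := by
  have hTY : Measurable[Y, Y] T := measurable_iff_comap_le.2 hYinv.le
  have hSY : Measurable[Y, Y] S := by
    refine measurable_iff_comap_le.2 ?_
    conv_lhs => rw [← hYinv]
    rw [MeasurableSpace.comap_comp]
    have : T ∘ S = id := funext hTS
    rw [this, MeasurableSpace.comap_id]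
  constructor
  · rintro hmix U mU hne hfin ℓ hℓ ⟨C, hC⟩
    exact forward hY hT.toMeasurePreserving hS hTS hSY hTY hYinv hmix U ℓ hℓ hC
  · intro h
    exact backward hY hT.toMeasurePreserving hS hST hTS hSY hTY hYinv
      fun ℓ hℓ hC => h Bool inferInstance inferInstance inferInstance ℓ hℓ hC

end ErgodicDecisions
end
end
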